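/- Let n ≥ 2, let A⁰ > 0 and A ∈ ℝⁿ with ‖A‖ ≤ A⁰, and let V(x) = A⁰√(1+‖x‖²) + ∑ᵢ Aⁱxⁱ. Let ĥ be a smooth compactly supported symmetric 2-tensor field on ℝⁿ which is trace-free with respect to the hyperbolic metric ḡ, i.e. ∑_{i,j} ḡ^{ij}(x) ĥ_{ij}(x) = 0 for all x. Then the following weighted integral identity holds: ∫_{ℝⁿ} |ĥ|²_ḡ V dμ = (1/(n+1)) ∫_{ℝⁿ} [ ( |∇̄ĥ|²_ḡ − |D̄ĥ|²_ḡ − |div̄ ĥ − ĥ_{dV}|²_ḡ ) + |ĥ_{dV}|²_ḡ ] V dμ, where dμ = (1+‖x‖²)^{−1/2} dx is the hyperbolic volume measure, (D̄ĥ)_{ijk} := (∇̄ᵢĥ_{jk} − ∇̄ⱼĥ_{ik})/√2, (div̄ ĥ)_j := −∑_{i,k} ḡ^{ik} ∇̄ᵢĥ_{kj}, (ĥ_{dV})_i := V^{-1} ∑_{j,k} ĥ_{ij} ḡ^{jk} ∂ₖV, and all norms are taken with indices raised by ḡ^{ij}: |ĥ|²_ḡ = ∑ ḡ^{ik}ḡ^{jℓ}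 ĥ_{ij}ĥ_{kℓ}, |∇̄ĥ|²_ḡ = ∑ ḡ^{km}ḡ^{ip}ḡ^{jq} ∇̄ₖĥ_{ij} ∇̄ₘĥ_{pq}, |D̄ĥ|²_ḡ = ∑ ḡ^{ip}ḡ^{jq}ḡ^{kr} (D̄ĥ)_{ijk}(D̄ĥ)_{pqr}, and for a covector w, |w|²_ḡ = ∑ ḡ^{ij} wᵢwⱼ. -/

import Mathlib

open Real MeasureTheory

noncomputable section

/-- The `i`-th partial derivative of `f : ℝⁿ → ℝ` at `x`. -/
def pd {n : ℕ} (f : (Fin n → ℝ) → ℝ) (i : Fin n) (x : Fin n → ℝ) : ℝ :=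
  fderiv ℝ f x (Pi.single i 1)

/-- Components of the hyperbolic metric on ℝⁿ:
`ḡ_{ij}(x) = δ_{ij} − xᵢxⱼ/(1+‖x‖²)`. -/
def gbar {n : ℕ} (i j : Fin n) (x : Fin n → ℝ) : ℝ :=
  (if i = j then 1 else 0) - x i * x j / (1 + ∑ k, x k ^ 2)

/-- Components of the inverse hyperbolic metric: `ḡ^{ij}(x) = δ_{ij} + xᵢxⱼ`. -/
def ginv {n : ℕ} (i j : Fin n) (x : Fin n → ℝ) : ℝ :=
  (if i = j then 1 else 0) + x i * x j

/-- Christoffel symbols `Γ̄^k_{ij}` of the hyperbolic metric. -/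
def Gam {n : ℕ} (k i j : Fin n) (x : Fin n → ℝ) : ℝ :=
  (1 / 2) * ∑ l, ginv k l x *
    (pd (gbar j l) i x + pd (gbar i l) j x - pd (gbar i j) l x)

/-- The static potential `V(x) = A⁰√(1+‖x‖²) + ∑ᵢ Aⁱxⁱ`. -/
def Vpot {n : ℕ} (A0 : ℝ) (A : Fin n → ℝ) (x : Fin n → ℝ) : ℝ :=
  A0 * Real.sqrt (1 + ∑ k, x k ^ 2) + ∑ i, A i * x i

/-- The `ḡ`-covariant derivative `∇̄ₖh_{ij}` of a symmetric 2-tensor field on ℝⁿ. -/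
def covDh {n : ℕ} (h : Fin n → Fin n → (Fin n → ℝ) → ℝ) (k i j : Fin n)
    (x : Fin n → ℝ) : ℝ :=
  pd (h i j) k x - ∑ l, (Gam l k i x * h l j x + Gam l k j x * h i l x)

/-- `|h|²_ḡ = ∑ ḡ^{ik} ḡ^{jℓ} h_{ij} h_{kℓ}`. -/
def hNormSq {n : ℕ} (h : Fin n → Fin n → (Fin n → ℝ) → ℝ) (x : Fin n → ℝ) : ℝ :=
  ∑ i, ∑ k, ∑ j, ∑ l, ginv i k x * ginv j l x * h i j x * h k l x

/-- `|∇̄h|²_ḡ = ∑ ḡ^{km} ḡ^{ip} ḡ^{jq} ∇̄ₖh_{ij} ∇̄ₘh_{pq}`. -/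
def covDNormSq {n : ℕ} (h : Fin n → Fin n → (Fin n → ℝ) → ℝ) (x : Fin n → ℝ) : ℝ :=
  ∑ k, ∑ m, ∑ i, ∑ p, ∑ j, ∑ q, ginv k m x * ginv i p x * ginv j q x *
    covDh h k i j x * covDh h m p q x

/-- `(D̄h)_{ijk} := (∇̄ᵢh_{jk} − ∇̄ⱼh_{ik})/√2`. -/
def Dbar {n : ℕ} (h : Fin n → Fin n → (Fin n → ℝ) → ℝ) (i j k : Fin n)
    (x : Fin n → ℝ) : ℝ :=
  (covDh h i j k x - covDh h j i k x) / Real.sqrt 2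

/-- `|D̄h|²_ḡ = ∑ ḡ^{ip} ḡ^{jq} ḡ^{kr} (D̄h)_{ijk} (D̄h)_{pqr}`. -/
def DbarNormSq {n : ℕ} (h : Fin n → Fin n → (Fin n → ℝ) → ℝ) (x : Fin n → ℝ) : ℝ :=
  ∑ i, ∑ p, ∑ j, ∑ q, ∑ k, ∑ r, ginv i p x * ginv j q x * ginv k r x *
    Dbar h i j k x * Dbar h p q r x

/-- `(div̄ h)_j := −∑_{i,k} ḡ^{ik} ∇̄ᵢh_{kj}`. -/
def divBar {n : ℕ} (h : Fin n → Fin n → (Fin n → ℝ) → ℝ) (j : Fin n)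
    (x : Fin n → ℝ) : ℝ :=
  -∑ i, ∑ k, ginv i k x * covDh h i k j x

/-- `(h_{dV})_i := V⁻¹ ∑_{j,k} h_{ij} ḡ^{jk} ∂ₖV`. -/
def hdV {n : ℕ} (A0 : ℝ) (A : Fin n → ℝ) (h : Fin n → Fin n → (Fin n → ℝ) → ℝ)
    (i : Fin n) (x : Fin n → ℝ) : ℝ :=
  (Vpot A0 A x)⁻¹ * ∑ j, ∑ k, h i j x * ginv j k x * pd (Vpot A0 A) k x

/-- `|w|²_ḡ = ∑ ḡ^{ij} wᵢ wⱼ` for a covector field `w`. -/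
def covecNormSq {n : ℕ} (w : Fin n → (Fin n → ℝ) → ℝ) (x : Fin n → ℝ) : ℝ :=
  ∑ i, ∑ j, ginv i j x * w i x * w j x

section PointwiseAlgebra

variable {ι : Type*} [Fintype ι]

/-- The quadratic expression `∇ₐh_{bc} ∇ᵇhᵃᶜ` in an orthonormal frame whose connection is
`∇ₐe_b = y_b eₐ − δ_{ab} y`. -/
lemma sum_connection_quadratic [DecidableEq ι] (y q d : ι → ℝ) (h : ι → ι → ℝ)
    (dh s : ι → ι → ι → ℝ)
    (hs : ∀ a b, h a b = h b a) (hds : ∀ c a b, dh c a b = dh c b a)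
    (htr : ∑ a, h a a = 0) (hdtr : ∀ c, ∑ a, dh c a a = 0)
    (hq : ∀ c, q c = ∑ e, y e * h e c) (hd : ∀ c, d c = ∑ b, dh b b c)
    (hsdef : ∀ c a b, s c a b = dh c a b - y a * h c b - y b * h a c
      + (if c = a then q b else 0) + (if c = b then q a else 0)) :
    ∑ a, ∑ b, ∑ c, s a b c * s b a c
      = ∑ a, ∑ b, ∑ c, dh a b c * dh b a c + 2 * ∑ c, q c * d c
        - 2 * ∑ a, ∑ b, ∑ c, y a * h b c * dh b a c
        - 2 * ∑ a, ∑ b, ∑ c, y a * h b c * dh a b c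
        + (∑ a, y a ^ 2) * ∑ b, ∑ c, h b c ^ 2
        + Fintype.card ι * ∑ c, q c ^ 2 := by
  set r : ι → ι → ι → ℝ := fun c a b => - y a * h c b - y b * h a c
      + (if c = a then q b else 0) + (if c = b then q a else 0) with hr
  have e1 : ∑ a, ∑ b, ∑ c, s a b c * s b a c
      = ∑ a, ∑ b, ∑ c, dh a b c * dh b a c + ∑ a, ∑ b, ∑ c, dh a b c * r b a c
        + ∑ a, ∑ b, ∑ c, r a b c * dh b a c + ∑ a, ∑ b, ∑ c, r a b c * r b a c := by
    simp only [← Finset.sum_add_distrib]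
    refine Finset.sum_congr rfl fun a _ => Finset.sum_congr rfl fun b _ =>
      Finset.sum_congr rfl fun c _ => ?_
    rw [hsdef, hsdef]; simp only [hr]; ring
  have e2 : ∑ a, ∑ b, ∑ c, r a b c * dh b a c = ∑ a, ∑ b, ∑ c, dh a b c * r b a c := by
    rw [Finset.sum_comm]
    simp only [mul_comm]
  have e3 : ∑ a, ∑ b, ∑ c, dh a b c * r b a c = ∑ c, q c * d c
        - ∑ a, ∑ b, ∑ c, y a * h b c * dh b a c - ∑ a, ∑ b, ∑ c, y a * h b c * dh a b c := by
    have t1 : ∑ a, ∑ b, ∑ c, dh a b c * (if b = a then q c else 0) = ∑ c, q c * d c := by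
      simp only [mul_ite, mul_zero]
      have : ∀ a : ι, ∑ b, ∑ c, (if b = a then dh a b c * q c else 0)
          = ∑ c, dh a a c * q c := fun a => by
        rw [Finset.sum_comm]; simp
      simp only [this]
      rw [Finset.sum_comm]
      refine Finset.sum_congr rfl fun c _ => ?_
      rw [hd, Finset.mul_sum]
      exact Finset.sum_congr rfl fun _ _ => mul_comm _ _
    have t2 : ∑ a, ∑ b, ∑ c, dh a b c * (if b = c then q a else 0) = 0 := by
      refine Finset.sum_eq_zero fun a _ => ?_
      simp only [mul_ite, mul_zero, Finset.sum_ite_eq, Finset.mem_univ, if_true]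
      rw [← Finset.sum_mul, hdtr, zero_mul]
    have t3 : ∑ a, ∑ b, ∑ c, dh a b c * (y c * h a b)
        = ∑ a, ∑ b, ∑ c, y a * h b c * dh b a c := by
      have : ∀ a : ι, ∑ b, ∑ c, dh a b c * (y c * h a b)
          = ∑ c, ∑ b, y c * h a b * dh a c b := fun a => by
        rw [Finset.sum_comm]
        refine Finset.sum_congr rfl fun c _ => Finset.sum_congr rfl fun b _ => ?_
        rw [hds a b c]; ring
      simp only [this]
      rw [Finset.sum_comm]
    have t4 : ∑ a, ∑ b, ∑ c, dh a b c * r b a c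
        = ∑ a, ∑ b, ∑ c, dh a b c * (if b = a then q c else 0)
          + ∑ a, ∑ b, ∑ c, dh a b c * (if b = c then q a else 0)
          - ∑ a, ∑ b, ∑ c, dh a b c * (y c * h a b)
          - ∑ a, ∑ b, ∑ c, y a * h b c * dh a b c := by
      simp only [← Finset.sum_add_distrib, ← Finset.sum_sub_distrib]
      refine Finset.sum_congr rfl fun a _ => Finset.sum_congr rfl fun b _ =>
        Finset.sum_congr rfl fun c _ => ?_
      simp only [hr]; ring
    rw [t4, t1, t2, t3, add_zero]
  have e4 : ∑ a, ∑ b, ∑ c, r a b c * r b a c = (∑ a, y a ^ 2) * ∑ b, ∑ c, h b c ^ 2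
        + Fintype.card ι * ∑ c, q c ^ 2 := by
    have hq' : ∀ c, ∑ e, h c e * y e = q c := fun c => by
      rw [hq]; exact Finset.sum_congr rfl fun e _ => by rw [hs]; ring
    have expand : ∀ a b c, r a b c * r b a c =
        y b * h a c * (y a * h b c) + y b * h a c * (y c * h a b)
        + y c * h a b * (y a * h b c) + y c ^ 2 * h a b ^ 2
        - (if a = b then y b * h a c * q c + 2 * (y c * h a b * q c) + q c * (y a * h b c)
            - q c ^ 2 else 0)
        - (if b = c then (y b * h a c + y c * h a b) * q a else 0)
        - (if a = c then (y a * h b c + y c * h a b) * q b else 0)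
        + (if a = b then (if b = c then q c * q a else 0) else 0)
        + (if a = b then (if a = c then q c * q b else 0) else 0)
        + (if a = c then (if b = c then q a * q b else 0) else 0) := fun a b c => by
      simp only [hr, eq_comm (a := b) (b := a)]
      rw [hs b a]
      split_ifs <;> ring
    simp only [expand]
    simp only [Finset.sum_add_distrib, Finset.sum_sub_distrib]
    have u1 : ∑ a, ∑ b, ∑ c, y b * h a c * (y a * h b c) = ∑ c, q c ^ 2 := by
      have : ∀ a : ι, ∑ b, ∑ c, y b * h a c * (y a * h b c) = ∑ c, y a * h a c * q c :=
        fun a => by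
          rw [Finset.sum_comm]
          refine Finset.sum_congr rfl fun c _ => ?_
          rw [hq, Finset.mul_sum]
          exact Finset.sum_congr rfl fun _ _ => by ring
      simp only [this]
      rw [Finset.sum_comm]
      refine Finset.sum_congr rfl fun c _ => ?_
      rw [← Finset.sum_mul, ← hq, sq]
    have u2 : ∑ a, ∑ b, ∑ c, y b * h a c * (y c * h a b) = ∑ c, q c ^ 2 := by
      refine Finset.sum_congr rfl fun a _ => ?_
      rw [sq, ← hq' a, Finset.sum_mul_sum]
      exact Finset.sum_congr rfl fun _ _ => Finset.sum_congr rfl fun _ _ => by ring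
    have u3 : ∑ a, ∑ b, ∑ c, y c * h a b * (y a * h b c) = ∑ c, q c ^ 2 := by
      rw [Finset.sum_comm]
      refine Finset.sum_congr rfl fun b _ => ?_
      rw [sq, ← hq' b, Finset.sum_mul_sum]
      exact Finset.sum_congr rfl fun a _ => Finset.sum_congr rfl fun _ _ => by
        rw [hs a b]; ring
    have u4 : ∑ a, ∑ b, ∑ c, y c ^ 2 * h a b ^ 2 = (∑ a, y a ^ 2) * ∑ b, ∑ c, h b c ^ 2 := by
      rw [Finset.mul_sum]
      refine Finset.sum_congr rfl fun a _ => ?_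
      rw [Finset.mul_sum]
      refine Finset.sum_congr rfl fun b _ => ?_
      rw [Finset.sum_mul]
    have k1 : ∑ a, ∑ c, y a * h a c * q c = ∑ c, q c ^ 2 := by
      rw [Finset.sum_comm]
      refine Finset.sum_congr rfl fun c _ => ?_
      rw [← Finset.sum_mul, ← hq, sq]
    have k2 : ∑ a, ∑ c, y a * h c a * q c = ∑ c, q c ^ 2 := by
      rw [← k1]
      exact Finset.sum_congr rfl fun _ _ => Finset.sum_congr rfl fun _ _ => by rw [hs]
    have u5 : ∑ a, ∑ b, ∑ c, (if a = b then y b * h a c * q c + 2 * (y c * h a b * q c)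
        + q c * (y a * h b c) - q c ^ 2 else 0)
        = 2 * ∑ c, q c ^ 2 - Fintype.card ι * ∑ c, q c ^ 2 := by
      have : ∀ a : ι, ∑ b, ∑ c, (if a = b then y b * h a c * q c + 2 * (y c * h a b * q c)
        + q c * (y a * h b c) - q c ^ 2 else 0)
          = 2 * ∑ c, y a * h a c * q c + 2 * (h a a * ∑ c, y c * q c) - ∑ c, q c ^ 2 :=
        fun a => by
          rw [Finset.sum_comm]
          simp only [Finset.sum_ite_eq, Finset.mem_univ, if_true, Finset.mul_sum,
            ← Finset.sum_add_distrib, ← Finset.sum_sub_distrib]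
          exact Finset.sum_congr rfl fun _ _ => by ring
      simp only [this, Finset.sum_add_distrib, Finset.sum_sub_distrib, ← Finset.mul_sum,
        ← Finset.sum_mul, htr, k1]
      simp
    have u6 : ∑ a, ∑ b, ∑ c, (if b = c then (y b * h a c + y c * h a b) * q a else 0)
        = 2 * ∑ c, q c ^ 2 := by
      simp only [Finset.sum_ite_eq, Finset.mem_univ, if_true]
      rw [← k2, Finset.sum_comm, Finset.mul_sum]
      refine Finset.sum_congr rfl fun _ _ => ?_
      rw [Finset.mul_sum]
      exact Finset.sum_congr rfl fun _ _ => by ring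
    have u7 : ∑ a, ∑ b, ∑ c, (if a = c then (y a * h b c + y c * h a b) * q b else 0)
        = 2 * ∑ c, q c ^ 2 := by
      simp only [Finset.sum_ite_eq, Finset.mem_univ, if_true]
      rw [← k2, Finset.mul_sum]
      refine Finset.sum_congr rfl fun a _ => ?_
      rw [Finset.mul_sum]
      exact Finset.sum_congr rfl fun b _ => by rw [hs a b]; ring
    have u8 : ∑ a, ∑ b, ∑ c, (if a = b then (if b = c then q c * q a else 0) else 0)
        = ∑ c, q c ^ 2 := by
      refine Finset.sum_congr rfl fun a _ => ?_
      rw [Finset.sum_comm]; simp [sq]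
    have u9 : ∑ a, ∑ b, ∑ c, (if a = b then (if a = c then q c * q b else 0) else 0)
        = ∑ c, q c ^ 2 := by
      refine Finset.sum_congr rfl fun a _ => ?_
      rw [Finset.sum_comm]; simp [sq]
    have u10 : ∑ a, ∑ b, ∑ c, (if a = c then (if b = c then q a * q b else 0) else 0)
        = ∑ c, q c ^ 2 := by
      refine Finset.sum_congr rfl fun a _ => ?_
      simp [sq]
    rw [u1, u2, u3, u4, u5, u6, u7, u8, u9, u10]; ring
  rw [e1, e2, e3, e4]; ring

lemma sum_div_connection [DecidableEq ι] (y q d : ι → ℝ) (h : ι → ι → ℝ)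
    (dh s : ι → ι → ι → ℝ) (htr : ∑ a, h a a = 0)
    (hq : ∀ c, q c = ∑ e, y e * h e c) (hd : ∀ c, d c = ∑ b, dh b b c)
    (hsdef : ∀ c a b, s c a b = dh c a b - y a * h c b - y b * h a c
      + (if c = a then q b else 0) + (if c = b then q a else 0)) (c : ι) :
    ∑ b, s b b c = d c + Fintype.card ι * q c := by
  simp only [hsdef, Finset.sum_add_distrib, Finset.sum_sub_distrib, ← Finset.mul_sum, htr,
    ← hq, ← hd]
  simp
  ring

/-- The divergence of `U`, the second-order part of the vector field in the Weitzenböck-type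
argument. -/
lemma sum_div_second_order [DecidableEq ι] (κ : ℝ) (y q d U dU : ι → ℝ) (h : ι → ι → ℝ)
    (dh s : ι → ι → ι → ℝ) (dd : ι → ι → ι → ι → ℝ)
    (hs : ∀ a b, h a b = h b a) (hds : ∀ c a b, dh c a b = dh c b a)
    (htr : ∑ a, h a a = 0) (hdtr : ∀ c, ∑ a, dh c a a = 0)
    (hq : ∀ c, q c = ∑ e, y e * h e c) (hd : ∀ c, d c = ∑ b, dh b b c)
    (hsdef : ∀ c a b, s c a b = dh c a b - y a * h c b - y b * h a c
      + (if c = a then q b else 0) + (if c = b then q a else 0))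
    (hκ : ∑ a, y a ^ 2 = 1 - 2 * κ)
    (hcomm : ∀ a b c e, dd a b c e = dd b a c e + y b * dh a c e - y a * dh b c e)
    (hU : ∀ a, U a = ∑ b, ∑ c, h b c * dh b a c - y a * ∑ b, ∑ c, h b c ^ 2
      - ∑ c, h a c * d c - Fintype.card ι * ∑ c, h a c * q c)
    (hdU : ∀ a, dU a = ∑ b, ∑ c, (dh a b c * dh b a c + h b c * dd a b a c)
      - (κ * ∑ b, ∑ c, h b c ^ 2 + y a * ∑ b, ∑ c, 2 * h b c * dh a b c)
      - ∑ c, (dh a a c * d c + h a c * ∑ b, dd a b b c)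
      - Fintype.card ι * ∑ c, (dh a a c * q c + h a c * (κ * h a c + ∑ e, y e * dh a e c))) :
    ∑ a, (dU a + (Fintype.card ι - 1) * y a * U a)
      = ∑ a, ∑ b, ∑ c, s a b c * s b a c - ∑ c, (∑ b, s b b c) ^ 2
        - Fintype.card ι * ∑ b, ∑ c, h b c ^ 2 := by
  rw [sum_connection_quadratic y q d h dh s hs hds htr hdtr hq hd hsdef]
  simp only [sum_div_connection y q d h dh s htr hq hd hsdef]
  have hq' : ∀ c, ∑ e, h c e * y e = q c := fun c => by
    rw [hq]; exact Finset.sum_congr rfl fun e _ => by rw [hs]; ring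
  have c1 : ∑ a, ∑ c, h a c * ∑ b, dd a b b c
      = ∑ a, ∑ b, ∑ c, h b c * dd a b a c - ∑ c, q c * d c
        + ∑ a, ∑ b, ∑ c, y a * h b c * dh b a c := by
    have w1 : ∑ a, ∑ c, h a c * ∑ b, dd a b b c = ∑ a, ∑ b, ∑ c, h b c * dd b a a c := by
      rw [Finset.sum_comm (s := Finset.univ (α := ι)) (t := Finset.univ (α := ι))
        (f := fun a b => ∑ c, h b c * dd b a a c)]
      refine Finset.sum_congr rfl fun a _ => ?_
      rw [Finset.sum_comm]
      exact Finset.sum_congr rfl fun c _ => Finset.mul_sum _ _ _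
    have w2 : ∑ c, q c * d c = ∑ a, ∑ b, ∑ c, h b c * (y b * dh a a c) := by
      have : ∀ a : ι, ∑ b, ∑ c, h b c * (y b * dh a a c) = ∑ c, q c * dh a a c := fun a => by
        rw [Finset.sum_comm]
        refine Finset.sum_congr rfl fun c _ => ?_
        rw [hq, Finset.sum_mul]
        exact Finset.sum_congr rfl fun _ _ => by ring
      simp only [this]
      rw [Finset.sum_comm]
      exact Finset.sum_congr rfl fun c _ => by rw [hd, Finset.mul_sum]
    rw [w1, w2]
    simp only [← Finset.sum_add_distrib, ← Finset.sum_sub_distrib]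
    refine Finset.sum_congr rfl fun a _ => Finset.sum_congr rfl fun b _ =>
      Finset.sum_congr rfl fun c _ => ?_
    rw [hcomm a b]; ring
  have c2 : ∑ a, ∑ c, dh a a c * d c = ∑ c, d c ^ 2 := by
    rw [Finset.sum_comm]
    exact Finset.sum_congr rfl fun c _ => by rw [← Finset.sum_mul, ← hd, sq]
  have c3 : ∑ a, ∑ c, dh a a c * q c = ∑ c, q c * d c := by
    rw [Finset.sum_comm]
    exact Finset.sum_congr rfl fun c _ => by rw [← Finset.sum_mul, ← hd, mul_comm]
  have c4 : ∑ a, ∑ c, h a c * (κ * h a c + ∑ e, y e * dh a e c)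
      = κ * ∑ b, ∑ c, h b c ^ 2 + ∑ a, ∑ b, ∑ c, y a * h b c * dh b a c := by
    rw [Finset.sum_comm (s := Finset.univ (α := ι)) (t := Finset.univ (α := ι))
      (f := fun a b => ∑ c, y a * h b c * dh b a c), Finset.mul_sum, ← Finset.sum_add_distrib]
    refine Finset.sum_congr rfl fun a _ => ?_
    rw [Finset.sum_comm, Finset.mul_sum, ← Finset.sum_add_distrib]
    refine Finset.sum_congr rfl fun c _ => ?_
    rw [mul_add, Finset.mul_sum]
    congr 1
    · ring
    · exact Finset.sum_congr rfl fun _ _ => by ring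
  have c5 : ∑ a, y a * ∑ b, ∑ c, 2 * h b c * dh a b c
      = 2 * ∑ a, ∑ b, ∑ c, y a * h b c * dh a b c := by
    simp only [Finset.mul_sum]
    exact Finset.sum_congr rfl fun _ _ => Finset.sum_congr rfl fun _ _ =>
      Finset.sum_congr rfl fun _ _ => by ring
  have c6 : ∑ a, y a * ∑ b, ∑ c, h b c * dh b a c
      = ∑ a, ∑ b, ∑ c, y a * h b c * dh b a c := by
    simp only [Finset.mul_sum]
    exact Finset.sum_congr rfl fun _ _ => Finset.sum_congr rfl fun _ _ =>
      Finset.sum_congr rfl fun _ _ => by ring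
  have c7 : ∀ z : ι → ℝ, ∑ a, y a * ∑ c, h a c * z c = ∑ c, q c * z c := fun z => by
    simp only [Finset.mul_sum]
    rw [Finset.sum_comm]
    refine Finset.sum_congr rfl fun c _ => ?_
    rw [hq, Finset.sum_mul]
    exact Finset.sum_congr rfl fun _ _ => by ring
  have c8 : ∑ c, (d c + Fintype.card ι * q c) ^ 2
      = ∑ c, d c ^ 2 + 2 * Fintype.card ι * ∑ c, q c * d c
        + (Fintype.card ι : ℝ) ^ 2 * ∑ c, q c ^ 2 := by
    simp only [Finset.mul_sum, ← Finset.sum_add_distrib]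
    exact Finset.sum_congr rfl fun _ _ => by ring
  have c9 : ∑ a, (y a * (∑ b, ∑ c, h b c * dh b a c - y a * ∑ b, ∑ c, h b c ^ 2
        - ∑ c, h a c * d c - Fintype.card ι * ∑ c, h a c * q c))
      = ∑ a, ∑ b, ∑ c, y a * h b c * dh b a c - (1 - 2 * κ) * ∑ b, ∑ c, h b c ^ 2
        - ∑ c, q c * d c - Fintype.card ι * ∑ c, q c ^ 2 := by
    have c7q := c7 q
    simp only [← sq] at c7q
    rw [← c6, ← c7 d, ← c7q, ← hκ, Finset.sum_mul, Finset.mul_sum]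
    simp only [← Finset.sum_sub_distrib]
    exact Finset.sum_congr rfl fun _ _ => by ring
  have split : ∀ a, dU a + (Fintype.card ι - 1) * y a * U a
      = ∑ b, ∑ c, dh a b c * dh b a c + ∑ b, ∑ c, h b c * dd a b a c
        - κ * ∑ b, ∑ c, h b c ^ 2 - y a * ∑ b, ∑ c, 2 * h b c * dh a b c
        - ∑ c, dh a a c * d c - ∑ c, h a c * ∑ b, dd a b b c
        - Fintype.card ι * ∑ c, dh a a c * q c
        - Fintype.card ι * ∑ c, h a c * (κ * h a c + ∑ e, y e * dh a e c)
        + (Fintype.card ι - 1) * (y a * (∑ b, ∑ c, h b c * dh b a c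
          - y a * ∑ b, ∑ c, h b c ^ 2 - ∑ c, h a c * d c
          - Fintype.card ι * ∑ c, h a c * q c)) := fun a => by
    rw [hU, hdU]
    simp only [Finset.sum_add_distrib]
    ring
  simp only [split]
  simp only [Finset.sum_add_distrib, Finset.sum_sub_distrib]
  rw [← Finset.mul_sum _ (fun a => ∑ c, dh a a c * q c), ← Finset.mul_sum
    _ (fun a => ∑ c, h a c * (κ * h a c + ∑ e, y e * dh a e c)), ← Finset.mul_sum
    _ _ ((Fintype.card ι : ℝ) - 1), c9, c1, c2, c3, c4, c5, c8, hκ]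
  rw [Finset.sum_const, Finset.card_univ, nsmul_eq_mul]
  ring

/-- The divergence of the first-order part `h(h(dV))` of the vector field. -/
lemma sum_div_first_order [DecidableEq ι] (V : ℝ) (y v q d U dZ : ι → ℝ) (h : ι → ι → ℝ)
    (dh s : ι → ι → ι → ℝ)
    (htr : ∑ a, h a a = 0)
    (hq : ∀ c, q c = ∑ e, y e * h e c) (hd : ∀ c, d c = ∑ b, dh b b c)
    (hsdef : ∀ c a b, s c a b = dh c a b - y a * h c b - y b * h a c
      + (if c = a then q b else 0) + (if c = b then q a else 0))
    (hU : ∀ a, U a = ∑ b, ∑ c, h b c * dh b a c - y a * ∑ b, ∑ c, h b c ^ 2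
      - ∑ c, h a c * d c - Fintype.card ι * ∑ c, h a c * q c)
    (hdZ : ∀ a, dZ a = ∑ b, ∑ c, ((V * (if a = b then 1 else 0) + y b * v a
        - (if a = b then 1 else 0) * ∑ e, y e * v e) * (h a c * h b c)
      + v b * (dh a a c * h b c + h a c * dh a b c))) :
    ∑ a, (v a * U a - (dZ a + (Fintype.card ι - 1) * y a * ∑ b, ∑ c, v b * (h a c * h b c)))
      = - V * ∑ b, ∑ c, h b c ^ 2 - 2 * ∑ c, (∑ b, s b b c) * ∑ b, v b * h b c := by
  simp only [sum_div_connection y q d h dh s htr hq hd hsdef, hU, hdZ]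
  set p : ι → ℝ := fun c => ∑ b, v b * h b c with hp
  have hpv : ∀ z : ι → ℝ, ∑ a, v a * ∑ c, h a c * z c = ∑ c, z c * p c := fun z => by
    simp only [Finset.mul_sum, hp]
    rw [Finset.sum_comm]
    exact Finset.sum_congr rfl fun c _ => Finset.sum_congr rfl fun _ _ => by ring
  have g1 : ∀ a, ∑ b, ∑ c, v b * (h a c * h b c) = ∑ c, h a c * p c := fun a => by
    rw [Finset.sum_comm]
    simp only [hp, Finset.mul_sum]
    exact Finset.sum_congr rfl fun c _ => Finset.sum_congr rfl fun _ _ => by ring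
  have g2 : ∀ a, ∑ b, ∑ c, y b * (h a c * h b c) = ∑ c, h a c * q c := fun a => by
    rw [Finset.sum_comm]
    simp only [hq, Finset.mul_sum]
    exact Finset.sum_congr rfl fun c _ => Finset.sum_congr rfl fun _ _ => by ring
  have g3 : ∀ a, ∑ b, ∑ c, v b * (dh a a c * h b c) = ∑ c, dh a a c * p c := fun a => by
    rw [Finset.sum_comm]
    simp only [hp, Finset.mul_sum]
    exact Finset.sum_congr rfl fun c _ => Finset.sum_congr rfl fun _ _ => by ring
  have g4 : ∑ a, ∑ c, dh a a c * p c = ∑ c, d c * p c := by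
    rw [Finset.sum_comm]
    exact Finset.sum_congr rfl fun c _ => by rw [← Finset.sum_mul, ← hd]
  have g5 : ∑ a, ∑ b, ∑ c, v b * (h a c * dh a b c)
      = ∑ a, v a * ∑ b, ∑ c, h b c * dh b a c := by
    rw [Finset.sum_comm]
    simp only [Finset.mul_sum]
  have g6 : ∑ a, y a * ∑ c, h a c * p c = ∑ c, q c * p c := by
    simp only [Finset.mul_sum]
    rw [Finset.sum_comm]
    refine Finset.sum_congr rfl fun c _ => ?_
    rw [hq, Finset.sum_mul]
    exact Finset.sum_congr rfl fun _ _ => by ring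
  have split : ∀ a, ∑ b, ∑ c, ((V * (if a = b then 1 else 0) + y b * v a
        - (if a = b then 1 else 0) * ∑ e, y e * v e) * (h a c * h b c)
      + v b * (dh a a c * h b c + h a c * dh a b c))
      = (V - ∑ e, y e * v e) * ∑ c, h a c ^ 2 + v a * ∑ c, h a c * q c
        + ∑ c, dh a a c * p c + ∑ b, ∑ c, v b * (h a c * dh a b c) := fun a => by
    have g7 : ∑ c, h a c ^ 2 = ∑ b, ∑ c, (if a = b then 1 else 0) * (h a c * h b c) := by
      simp [sq]
    rw [g7, ← g2, ← g3]
    simp only [Finset.mul_sum (s := Finset.univ (α := ι)) (f := fun b => ∑ c, _), Finset.mul_sum,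
      ← Finset.sum_add_distrib]
    refine Finset.sum_congr rfl fun b _ => Finset.sum_congr rfl fun c _ => ?_
    simp only [← Finset.mul_sum]
    ring
  simp only [split, g1]
  have assemble : ∀ a, v a * (∑ b, ∑ c, h b c * dh b a c - y a * ∑ b, ∑ c, h b c ^ 2
        - ∑ c, h a c * d c - Fintype.card ι * ∑ c, h a c * q c)
      - ((V - ∑ e, y e * v e) * ∑ c, h a c ^ 2 + v a * ∑ c, h a c * q c
        + ∑ c, dh a a c * p c + ∑ b, ∑ c, v b * (h a c * dh a b c)
        + (Fintype.card ι - 1) * y a * ∑ c, h a c * p c)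
      = v a * ∑ b, ∑ c, h b c * dh b a c - y a * v a * ∑ b, ∑ c, h b c ^ 2
        - v a * ∑ c, h a c * d c - (Fintype.card ι + 1) * (v a * ∑ c, h a c * q c)
        - (V - ∑ e, y e * v e) * ∑ c, h a c ^ 2
        - ∑ c, dh a a c * p c - ∑ b, ∑ c, v b * (h a c * dh a b c)
        - (Fintype.card ι - 1) * (y a * ∑ c, h a c * p c) := fun a => by ring
  simp only [assemble, Finset.sum_sub_distrib]
  rw [← Finset.mul_sum _ _ ((Fintype.card ι : ℝ) - 1),
    ← Finset.mul_sum _ _ ((Fintype.card ι : ℝ) + 1), ← Finset.mul_sum _ _ (V - _),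
    ← Finset.sum_mul, hpv, hpv, g4, g5, g6]
  simp only [add_mul, Finset.sum_add_distrib, mul_assoc, ← Finset.mul_sum]
  ring

end PointwiseAlgebra
section HyperbolicFrame

variable {n : ℕ}

/-- The function `√(1+‖x‖²)`. -/
def hypRad (x : Fin n → ℝ) : ℝ := Real.sqrt (1 + ∑ k, x k ^ 2)

/-- The coordinates `x / (1 + √(1+‖x‖²))` of the Poincaré ball model. -/
def ballCoord (a : Fin n) (x : Fin n → ℝ) : ℝ := x a * (1 + hypRad x)⁻¹

/-- The components of the orthonormal frame of the hyperbolic metric that is proportional to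
the coordinate frame of the Poincaré ball model. -/
def hypFrame (a i : Fin n) (x : Fin n → ℝ) : ℝ :=
  (if a = i then 1 else 0) + x a * ballCoord i x

/-- `f` is differentiable at `x`, with derivative `f'` along the `a`-th frame vector. -/
def HasFrameDerivAt (a : Fin n) (f : (Fin n → ℝ) → ℝ) (f' : ℝ) (x : Fin n → ℝ) : Prop :=
  DifferentiableAt ℝ f x ∧ fderiv ℝ f x (fun i => hypFrame a i x) = f'

/-- The derivative of `f` along the `a`-th frame vector. -/
def frameDeriv (a : Fin n) (f : (Fin n → ℝ) → ℝ) (x : Fin n → ℝ) : ℝ :=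
  fderiv ℝ f x (fun i => hypFrame a i x)

lemma one_add_sum_sq_pos (x : Fin n → ℝ) : 0 < 1 + ∑ k, x k ^ 2 := by positivity

lemma hypRad_pos (x : Fin n → ℝ) : 0 < hypRad x := Real.sqrt_pos.2 (one_add_sum_sq_pos x)

lemma one_add_hypRad_pos (x : Fin n → ℝ) : 0 < 1 + hypRad x := by linarith [hypRad_pos x]

lemma hypRad_sq (x : Fin n → ℝ) : hypRad x ^ 2 = 1 + ∑ k, x k ^ 2 :=
  Real.sq_sqrt (one_add_sum_sq_pos x).le

lemma sum_sq_eq (x : Fin n → ℝ) : ∑ k, x k ^ 2 = (hypRad x - 1) * (1 + hypRad x) := by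
  linarith [hypRad_sq x, mul_comm (hypRad x - 1) (1 + hypRad x)]

lemma coord_eq_mul_ballCoord (a : Fin n) (x : Fin n → ℝ) :
    x a = (1 + hypRad x) * ballCoord a x := by
  have := (one_add_hypRad_pos x).ne'
  unfold ballCoord
  field_simp

lemma sum_coord_mul_ballCoord (x : Fin n → ℝ) : ∑ a, x a * ballCoord a x = hypRad x - 1 := by
  have := (one_add_hypRad_pos x).ne'
  simp only [ballCoord, ← mul_assoc, ← sq, ← Finset.sum_mul, sum_sq_eq]
  field_simp

lemma sum_ballCoord_sq (x : Fin n → ℝ) :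
    ∑ a, ballCoord a x ^ 2 = 1 - 2 * (1 + hypRad x)⁻¹ := by
  have h := (one_add_hypRad_pos x).ne'
  simp only [ballCoord, mul_pow, ← Finset.sum_mul, sum_sq_eq]
  field_simp
  ring

lemma contDiff_hypRad : ContDiff ℝ (⊤ : ℕ∞) (hypRad (n := n)) := by
  unfold hypRad
  exact ContDiff.sqrt (by fun_prop) fun x => (one_add_sum_sq_pos x).ne'

lemma contDiff_ballCoord (a : Fin n) : ContDiff ℝ (⊤ : ℕ∞) (ballCoord a) := by
  unfold ballCoord
  exact ContDiff.mul (by fun_prop) ((contDiff_const.add contDiff_hypRad).inv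
    fun x => (one_add_hypRad_pos x).ne')

lemma contDiff_hypFrame (a i : Fin n) : ContDiff ℝ (⊤ : ℕ∞) (hypFrame a i) := by
  unfold hypFrame
  exact contDiff_const.add (ContDiff.mul (by fun_prop) (contDiff_ballCoord i))

lemma contDiff_frameDeriv (a : Fin n) {f : (Fin n → ℝ) → ℝ} (hf : ContDiff ℝ (⊤ : ℕ∞) f) :
    ContDiff ℝ (⊤ : ℕ∞) (frameDeriv a f) := by
  unfold frameDeriv
  exact (hf.fderiv_right (m := (⊤ : ℕ∞)) (by simp)).clm_apply
    (contDiff_pi.2 fun i => contDiff_hypFrame a i)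

lemma fderiv_apply_eq_sum_pd (f : (Fin n → ℝ) → ℝ) (x v : Fin n → ℝ) :
    fderiv ℝ f x v = ∑ i, v i * pd f i x := by
  have hv : v = ∑ i, v i • (Pi.single i 1 : Fin n → ℝ) := by
    ext j
    simp [Finset.sum_apply, Pi.single_apply]
  conv_lhs => rw [hv]
  simp [pd, map_sum]

lemma frameDeriv_eq_sum (a : Fin n) (f : (Fin n → ℝ) → ℝ) (x : Fin n → ℝ) :
    frameDeriv a f x = ∑ i, hypFrame a i x * pd f i x := fderiv_apply_eq_sum_pd f x _

lemma hasFDerivAt_hypRad (x : Fin n → ℝ) : HasFDerivAt hypRad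
    ((hypRad x)⁻¹ • ∑ k, x k • ContinuousLinearMap.proj (R := ℝ) (φ := fun _ : Fin n => ℝ) k)
    x := by
  have h1 : HasFDerivAt (fun y : Fin n → ℝ => 1 + ∑ k, y k ^ 2)
      (∑ k, (2 * x k) • ContinuousLinearMap.proj (R := ℝ) (φ := fun _ : Fin n => ℝ) k) x := by
    refine HasFDerivAt.const_add 1 (HasFDerivAt.fun_sum fun k _ => ?_)
    simpa using (ContinuousLinearMap.proj (R := ℝ) (φ := fun _ : Fin n => ℝ) k).hasFDerivAt.pow 2
      (x := x)
  refine (h1.sqrt (one_add_sum_sq_pos x).ne').congr_fderiv ?_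
  rw [Finset.smul_sum, Finset.smul_sum]
  refine Finset.sum_congr rfl fun k _ => ?_
  rw [smul_smul, smul_smul]
  congr 1
  have := (hypRad_pos x).ne'
  rw [show √(1 + ∑ k, x k ^ 2) = hypRad x from rfl]
  field_simp

namespace HasFrameDerivAt

variable {a : Fin n} {f g : (Fin n → ℝ) → ℝ} {f' g' : ℝ} {x : Fin n → ℝ}

lemma congr_deriv (hf : HasFrameDerivAt a f f' x) (h : f' = g') : HasFrameDerivAt a f g' x :=
  h ▸ hf

lemma frameDeriv_eq (hf : HasFrameDerivAt a f f' x) : frameDeriv a f x = f' := hf.2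

lemma of_hasFDerivAt {L : (Fin n → ℝ) →L[ℝ] ℝ} (h : HasFDerivAt f L x) :
    HasFrameDerivAt a f (L fun i => hypFrame a i x) x :=
  ⟨h.differentiableAt, by rw [h.fderiv]⟩

lemma of_contDiff (hf : ContDiff ℝ (⊤ : ℕ∞) f) : HasFrameDerivAt a f (frameDeriv a f x) x :=
  ⟨hf.differentiable (by simp) x, rfl⟩

lemma const (c : ℝ) : HasFrameDerivAt a (fun _ => c) 0 x := by
  simpa using of_hasFDerivAt (a := a) (hasFDerivAt_const c x)

lemma add (hf : HasFrameDerivAt a f f' x) (hg : HasFrameDerivAt a g g' x) :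
    HasFrameDerivAt a (fun y => f y + g y) (f' + g') x :=
  ⟨hf.1.add hg.1, by rw [fderiv_fun_add hf.1 hg.1, ← hf.2, ← hg.2]; rfl⟩

lemma sub (hf : HasFrameDerivAt a f f' x) (hg : HasFrameDerivAt a g g' x) :
    HasFrameDerivAt a (fun y => f y - g y) (f' - g') x :=
  ⟨hf.1.sub hg.1, by rw [fderiv_fun_sub hf.1 hg.1, ← hf.2, ← hg.2]; rfl⟩

lemma mul (hf : HasFrameDerivAt a f f' x) (hg : HasFrameDerivAt a g g' x) :
    HasFrameDerivAt a (fun y => f y * g y) (f' * g x + f x * g') x :=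
  ⟨hf.1.mul hg.1, by
    rw [fderiv_fun_mul hf.1 hg.1, ← hf.2, ← hg.2]
    simp only [add_apply, smul_apply, smul_eq_mul]
    ring⟩

lemma inv (hf : HasFrameDerivAt a f f' x) (h0 : f x ≠ 0) :
    HasFrameDerivAt a (fun y => (f y)⁻¹) (-f' / f x ^ 2) x := by
  refine (of_hasFDerivAt ((hasDerivAt_inv h0).comp_hasFDerivAt x hf.1.hasFDerivAt)).congr_deriv ?_
  rw [← hf.2]
  simp only [smul_apply, smul_eq_mul]
  ring

lemma sum {ι : Type*} {s : Finset ι} {F : ι → (Fin n → ℝ) → ℝ} {F' : ι → ℝ}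
    (hF : ∀ i ∈ s, HasFrameDerivAt a (F i) (F' i) x) :
    HasFrameDerivAt a (fun y => ∑ i ∈ s, F i y) (∑ i ∈ s, F' i) x :=
  ⟨DifferentiableAt.fun_sum fun i hi => (hF i hi).1, by
    rw [fderiv_fun_sum fun i hi => (hF i hi).1, _root_.sum_apply]
    exact Finset.sum_congr rfl fun i hi => (hF i hi).2⟩

end HasFrameDerivAt

lemma hasFrameDerivAt_coord (a b : Fin n) (x : Fin n → ℝ) :
    HasFrameDerivAt a (fun y => y b) (hypFrame a b x) x :=
  HasFrameDerivAt.of_hasFDerivAt (hasFDerivAt_apply b x)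

lemma sum_coord_mul_hypFrame (a : Fin n) (x : Fin n → ℝ) :
    ∑ i, x i * hypFrame a i x = hypRad x * x a := by
  have : ∀ i, x i * hypFrame a i x
      = (if a = i then x i else 0) + x a * (x i * ballCoord i x) := fun i => by
    unfold hypFrame; split_ifs <;> ring
  simp only [this, Finset.sum_add_distrib, ← Finset.mul_sum, sum_coord_mul_ballCoord]
  simp
  ring

lemma hasFrameDerivAt_hypRad (a : Fin n) (x : Fin n → ℝ) :
    HasFrameDerivAt a hypRad (x a) x := by
  refine (HasFrameDerivAt.of_hasFDerivAt (hasFDerivAt_hypRad x)).congr_deriv ?_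
  have := (hypRad_pos x).ne'
  simp only [smul_apply, _root_.sum_apply,
    ContinuousLinearMap.proj_apply, smul_eq_mul, sum_coord_mul_hypFrame]
  field_simp

lemma hasFrameDerivAt_ballCoord (a b : Fin n) (x : Fin n → ℝ) :
    HasFrameDerivAt a (ballCoord b) (if a = b then (1 + hypRad x)⁻¹ else 0) x := by
  have h := (one_add_hypRad_pos x).ne'
  refine ((hasFrameDerivAt_coord a b x).mul
    (((HasFrameDerivAt.const 1).add (hasFrameDerivAt_hypRad a x)).inv h)).congr_deriv ?_
  unfold hypFrame ballCoord
  split_ifs <;> field_simp <;> ring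

lemma hasFrameDerivAt_hypFrame (c a i : Fin n) (x : Fin n → ℝ) :
    HasFrameDerivAt c (hypFrame a i)
      ((if c = a then ballCoord i x else 0) + ballCoord a x * hypFrame c i x) x := by
  refine ((HasFrameDerivAt.const _).add
    ((hasFrameDerivAt_coord c a x).mul (hasFrameDerivAt_ballCoord c i x))).congr_deriv ?_
  unfold hypFrame ballCoord
  split_ifs <;> ring

lemma sum_hypFrame_mul_hypFrame (i j : Fin n) (x : Fin n → ℝ) :
    ∑ a, hypFrame a i x * hypFrame a j x = ginv i j x := by
  have e : ∀ a, hypFrame a i x * hypFrame a j x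
      = (if a = i then (if a = j then 1 else 0) + x a * ballCoord j x else 0)
        + (if a = j then x a * ballCoord i x else 0)
        + x a ^ 2 * (ballCoord i x * ballCoord j x) := fun a => by
    unfold hypFrame; split_ifs <;> ring
  simp only [e, Finset.sum_add_distrib, ← Finset.sum_mul, sum_sq_eq]
  simp only [Finset.sum_ite_eq', Finset.mem_univ, if_true, ginv]
  rw [coord_eq_mul_ballCoord i x, coord_eq_mul_ballCoord j x]
  ring

lemma sum_ballCoord_mul_hypFrame (i : Fin n) (x : Fin n → ℝ) :
    ∑ a, ballCoord a x * hypFrame a i x = hypRad x * ballCoord i x := by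
  have : ∀ a, ballCoord a x * hypFrame a i x
      = (if a = i then ballCoord a x else 0) + x a * ballCoord a x * ballCoord i x := fun a => by
    unfold hypFrame; split_ifs <;> ring
  simp only [this, Finset.sum_add_distrib, ← Finset.sum_mul, sum_coord_mul_ballCoord]
  simp
  ring

lemma sum_hypFrame_mul_gbar (a b : Fin n) (x : Fin n → ℝ) :
    ∑ i, ∑ j, hypFrame a i x * hypFrame b j x * gbar i j x = if a = b then 1 else 0 := by
  have h0 := (hypRad_pos x).ne'
  have e : ∀ i, ∑ j, hypFrame a i x * hypFrame b j x * gbar i j x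
      = hypFrame b i x * hypFrame a i x
        - x b * (hypRad x)⁻¹ * (x i * hypFrame a i x) := fun i => by
    have e' : ∀ j, hypFrame a i x * hypFrame b j x * gbar i j x
        = (if i = j then hypFrame a i x * hypFrame b j x else 0)
          - hypFrame a i x * x i / (1 + ∑ k, x k ^ 2) * (x j * hypFrame b j x) := fun j => by
      unfold gbar; split_ifs <;> ring
    simp only [e', Finset.sum_sub_distrib, ← Finset.mul_sum, sum_coord_mul_hypFrame]
    rw [← hypRad_sq]
    simp
    field_simp
  have e2 : ∀ i, hypFrame b i x * hypFrame a i x = (if b = i then hypFrame a i x else 0)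
      + (1 + hypRad x)⁻¹ * x b * (x i * hypFrame a i x) := fun i => by
    rw [show hypFrame b i x = (if b = i then 1 else 0) + x b * ballCoord i x from rfl]
    unfold ballCoord
    split_ifs <;> ring
  simp only [e, e2, Finset.sum_sub_distrib, Finset.sum_add_distrib, ← Finset.mul_sum,
    sum_coord_mul_hypFrame]
  simp only [Finset.sum_ite_eq, Finset.mem_univ, if_true, hypFrame, ballCoord]
  have := (one_add_hypRad_pos x).ne'
  field_simp
  ring

/-- `[eₐ, e_b] = y_b eₐ − yₐ e_b`. -/
lemma frameDeriv_comm (a b : Fin n) {f : (Fin n → ℝ) → ℝ} (hf : ContDiff ℝ (⊤ : ℕ∞) f)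
    (x : Fin n → ℝ) :
    frameDeriv a (frameDeriv b f) x = frameDeriv b (frameDeriv a f) x
      + ballCoord b x * frameDeriv a f x - ballCoord a x * frameDeriv b f x := by
  have hsym : IsSymmSndFDerivAt ℝ f x :=
    (hf.contDiffAt (x := x)).isSymmSndFDerivAt
      (by
        rw [minSmoothness_of_isRCLikeNormedField]
        exact WithTop.coe_le_coe.2 (le_top : (2 : ℕ∞) ≤ ⊤))
  have hd : DifferentiableAt ℝ (fderiv ℝ f) x :=
    (hf.fderiv_right (m := (⊤ : ℕ∞)) (by simp)).differentiable (by simp) x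
  have hE : ∀ b, DifferentiableAt ℝ (fun y i => hypFrame b i y) x := fun b =>
    differentiableAt_pi.2 fun i => (contDiff_hypFrame b i).differentiable (by simp) x
  have key : ∀ a b, frameDeriv a (frameDeriv b f) x
      = fderiv ℝ (fderiv ℝ f) x (fun i => hypFrame a i x) (fun i => hypFrame b i x)
        + (if a = b then ∑ i, ballCoord i x * pd f i x else 0)
        + ballCoord b x * frameDeriv a f x := fun a b => by
    rw [frameDeriv_eq_sum a f]
    unfold frameDeriv
    rw [fderiv_clm_apply hd (hE b)]
    simp only [add_apply, ContinuousLinearMap.comp_apply,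
      ContinuousLinearMap.flip_apply]
    rw [fderiv_apply_eq_sum_pd f, add_comm, add_assoc]
    congr 1
    have hc : ∀ i, fderiv ℝ (fun y i => hypFrame b i y) x (fun i => hypFrame a i x) i
        = (if a = b then ballCoord i x else 0) + ballCoord b x * hypFrame a i x := fun i => by
      rw [fderiv_pi fun i => (contDiff_hypFrame b i).differentiable (by simp) x]
      exact (hasFrameDerivAt_hypFrame a b i x).2
    simp only [hc, Finset.mul_sum, add_mul, Finset.sum_add_distrib]
    split_ifs <;> simp [mul_assoc]
  rw [key a b, key b a, hsym.eq]
  simp only [eq_comm (a := b)]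
  ring

section Contraction

variable (x : Fin n → ℝ)

lemma sum_ginv_covec (f g : Fin n → ℝ) :
    ∑ i, ∑ k, ginv i k x * (f i * g k)
      = ∑ a, (∑ i, hypFrame a i x * f i) * ∑ k, hypFrame a k x * g k := by
  simp only [Finset.sum_mul_sum]
  symm
  rw [Finset.sum_comm]
  refine Finset.sum_congr rfl fun i _ => ?_
  rw [Finset.sum_comm]
  refine Finset.sum_congr rfl fun k _ => ?_
  rw [← sum_hypFrame_mul_hypFrame, Finset.sum_mul]
  exact Finset.sum_congr rfl fun _ _ => by ring

lemma sum_ginv_tensor (T S : Fin n → Fin n → ℝ) :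
    ∑ i, ∑ k, ∑ j, ∑ l, ginv i k x * ginv j l x * T i j * S k l
      = ∑ a, ∑ b, (∑ i, hypFrame a i x * ∑ j, hypFrame b j x * T i j)
        * ∑ i, hypFrame a i x * ∑ j, hypFrame b j x * S i j := by
  have e : ∀ i k, ∑ j, ∑ l, ginv i k x * ginv j l x * T i j * S k l
      = ∑ b, ginv i k x * ((∑ j, hypFrame b j x * T i j) * ∑ j, hypFrame b j x * S k j) :=
    fun i k => by
      rw [← Finset.mul_sum, ← sum_ginv_covec, Finset.mul_sum]
      refine Finset.sum_congr rfl fun _ _ => ?_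
      rw [Finset.mul_sum]
      exact Finset.sum_congr rfl fun _ _ => by ring
  simp only [e]
  rw [Finset.sum_comm (s := Finset.univ (α := Fin n)) (t := Finset.univ (α := Fin n))
    (f := fun a b => (∑ i, hypFrame a i x * ∑ j, hypFrame b j x * T i j) * _)]
  simp only [← sum_ginv_covec]
  rw [Finset.sum_comm (s := Finset.univ (α := Fin n)) (t := Finset.univ (α := Fin n))
    (f := fun b i => ∑ k, ginv i k x * _)]
  exact Finset.sum_congr rfl fun _ _ => Finset.sum_comm

lemma sum_ginv_tensor₃ (T S : Fin n → Fin n → Fin n → ℝ) :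
    ∑ k, ∑ m, ∑ i, ∑ p, ∑ j, ∑ q, ginv k m x * ginv i p x * ginv j q x * T k i j * S m p q
      = ∑ c, ∑ a, ∑ b,
        (∑ k, hypFrame c k x * ∑ i, hypFrame a i x * ∑ j, hypFrame b j x * T k i j)
        * ∑ k, hypFrame c k x * ∑ i, hypFrame a i x * ∑ j, hypFrame b j x * S k i j := by
  have e : ∀ k m, ∑ i, ∑ p, ∑ j, ∑ q,
        ginv k m x * ginv i p x * ginv j q x * T k i j * S m p q
      = ∑ a, ∑ b, ginv k m x * ((∑ i, hypFrame a i x * ∑ j, hypFrame b j x * T k i j)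
        * ∑ i, hypFrame a i x * ∑ j, hypFrame b j x * S m i j) := fun k m => by
    simp only [← Finset.mul_sum]
    rw [← sum_ginv_tensor]
    simp only [Finset.mul_sum]
    exact Finset.sum_congr rfl fun _ _ => Finset.sum_congr rfl fun _ _ =>
      Finset.sum_congr rfl fun _ _ => Finset.sum_congr rfl fun _ _ => by ring
  simp only [e]
  rw [Finset.sum_comm (s := Finset.univ (α := Fin n)) (t := Finset.univ (α := Fin n))
    (f := fun c a => ∑ b, (∑ k, hypFrame c k x * _) * _)]
  have e2 : ∀ k, ∑ m, ∑ a, ∑ b, ginv k m x *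
      ((∑ i, hypFrame a i x * ∑ j, hypFrame b j x * T k i j)
        * ∑ i, hypFrame a i x * ∑ j, hypFrame b j x * S m i j)
      = ∑ a, ∑ b, ∑ m, ginv k m x *
      ((∑ i, hypFrame a i x * ∑ j, hypFrame b j x * T k i j)
        * ∑ i, hypFrame a i x * ∑ j, hypFrame b j x * S m i j) := fun k => by
    rw [Finset.sum_comm]
    exact Finset.sum_congr rfl fun _ _ => Finset.sum_comm
  simp only [e2]
  rw [Finset.sum_comm]
  refine Finset.sum_congr rfl fun a _ => ?_
  rw [Finset.sum_comm, Finset.sum_comm (s := Finset.univ (α := Fin n))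
    (t := Finset.univ (α := Fin n)) (f := fun c b => (∑ k, hypFrame c k x * _) * _)]
  exact Finset.sum_congr rfl fun b _ => sum_ginv_covec x _ _

end Contraction

lemma pd_gbar (i j k : Fin n) (x : Fin n → ℝ) :
    pd (gbar i j) k x
      = -((if k = i then x j else 0) + (if k = j then x i else 0)) / hypRad x ^ 2
        + 2 * (x i * x j * x k) / hypRad x ^ 4 := by
  have h0 := (hypRad_pos x).ne'
  have hg : gbar i j = fun y : Fin n → ℝ => (if i = j then 1 else 0)
      - y i * y j * ((hypRad y)⁻¹ * (hypRad y)⁻¹) := by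
    funext y
    rw [gbar, ← hypRad_sq, ← mul_inv, ← sq, div_eq_mul_inv]
  have hc : ∀ l : Fin n, HasFDerivAt (fun y : Fin n → ℝ => y l)
      (ContinuousLinearMap.proj (R := ℝ) (φ := fun _ : Fin n => ℝ) l) x :=
    fun l => (ContinuousLinearMap.proj (R := ℝ) (φ := fun _ : Fin n => ℝ) l).hasFDerivAt
  have hi : HasFDerivAt (𝕜 := ℝ) (fun y : Fin n → ℝ => (hypRad y)⁻¹) _ x :=
    (hasDerivAt_inv (𝕜 := ℝ) h0).comp_hasFDerivAt x (hasFDerivAt_hypRad x)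
  have hd := HasFDerivAt.const_sub (((hc i).fun_mul (hc j)).fun_mul (hi.fun_mul hi))
    (if i = j then (1 : ℝ) else 0)
  rw [pd, hg, hd.fderiv]
  have hs : ∀ l, (Pi.single k (1 : ℝ) : Fin n → ℝ) l = if k = l then 1 else 0 := fun l => by
    simp [Pi.single_apply, eq_comm]
  simp only [neg_apply, add_apply, smul_apply, _root_.sum_apply,
    ContinuousLinearMap.proj_apply, smul_eq_mul, hs, mul_ite, mul_one, mul_zero,
    Finset.sum_ite_eq, Finset.mem_univ, if_true]
  split_ifs <;> field_simp <;> ring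

lemma Gam_eq (k i j : Fin n) (x : Fin n → ℝ) : Gam k i j x = -x k * gbar i j x := by
  have h0 := (hypRad_pos x).ne'
  have e : ∀ l, ginv k l x * (pd (gbar j l) i x + pd (gbar i l) j x - pd (gbar i j) l x)
      = -2 * gbar i j x / hypRad x ^ 2 * ((if k = l then x l else 0) + x k * x l ^ 2) :=
    fun l => by
      rw [pd_gbar, pd_gbar, pd_gbar, gbar, ← hypRad_sq, ginv]
      simp only [eq_comm (a := j) (b := i), eq_comm (a := l)]
      split_ifs <;> field_simp <;> ring
  rw [Gam]
  simp only [e, ← Finset.mul_sum, Finset.sum_add_distrib, sum_sq_eq]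
  simp
  field_simp
  ring

/-- The components of a tensor in the frame `hypFrame`. -/
def frameTensor (h : Fin n → Fin n → (Fin n → ℝ) → ℝ) (a b : Fin n) (x : Fin n → ℝ) : ℝ :=
  ∑ i, hypFrame a i x * ∑ j, hypFrame b j x * h i j x

/-- The contraction of a tensor with the ball coordinates. -/
def frameBall (h : Fin n → Fin n → (Fin n → ℝ) → ℝ) (c : Fin n) (x : Fin n → ℝ) : ℝ :=
  ∑ e, ballCoord e x * frameTensor h e c x

/-- The components of the covariant derivative of a tensor in the frame `hypFrame`. -/
def frameCov (h : Fin n → Fin n → (Fin n → ℝ) → ℝ) (c a b : Fin n) (x : Fin n → ℝ) : ℝ :=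
  frameDeriv c (frameTensor h a b) x - ballCoord a x * frameTensor h c b x
    - ballCoord b x * frameTensor h a c x
    + (if c = a then frameBall h b x else 0) + (if c = b then frameBall h a x else 0)

section FrameTensor

variable {h : Fin n → Fin n → (Fin n → ℝ) → ℝ}

lemma frameTensor_symm (hsymm : ∀ i j x, h i j x = h j i x) (a b : Fin n) (x : Fin n → ℝ) :
    frameTensor h a b x = frameTensor h b a x := by
  simp only [frameTensor, Finset.mul_sum]
  rw [Finset.sum_comm]
  exact Finset.sum_congr rfl fun i _ => Finset.sum_congr rfl fun j _ => by
    rw [hsymm i j]; ring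

lemma sum_frameTensor_self (x : Fin n → ℝ) :
    ∑ a, frameTensor h a a x = ∑ i, ∑ j, ginv i j x * h i j x := by
  simp only [frameTensor, Finset.mul_sum, ← sum_hypFrame_mul_hypFrame, Finset.sum_mul]
  rw [Finset.sum_comm]
  refine Finset.sum_congr rfl fun i _ => ?_
  rw [Finset.sum_comm]
  exact Finset.sum_congr rfl fun j _ => Finset.sum_congr rfl fun a _ => by ring

lemma contDiff_frameTensor (hsmooth : ∀ i j, ContDiff ℝ (⊤ : ℕ∞) (h i j)) (a b : Fin n) :
    ContDiff ℝ (⊤ : ℕ∞) (frameTensor h a b) := by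
  unfold frameTensor
  have := @contDiff_hypFrame n
  fun_prop

lemma frameBall_eq (b : Fin n) (x : Fin n → ℝ) :
    frameBall h b x = hypRad x * ∑ i, ballCoord i x * ∑ j, hypFrame b j x * h i j x := by
  have e : ∀ e, ballCoord e x * ∑ i, hypFrame e i x * ∑ j, hypFrame b j x * h i j x
      = ∑ i, ballCoord e x * (hypFrame e i x * ∑ j, hypFrame b j x * h i j x) := fun e => by
    rw [Finset.mul_sum]
  simp only [frameBall, frameTensor, e]
  rw [Finset.sum_comm, Finset.mul_sum]
  refine Finset.sum_congr rfl fun i _ => ?_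
  rw [← mul_assoc, ← sum_ballCoord_mul_hypFrame, Finset.sum_mul]
  exact Finset.sum_congr rfl fun _ _ => by ring

lemma frameDeriv_frameTensor (hsmooth : ∀ i j, ContDiff ℝ (⊤ : ℕ∞) (h i j))
    (hsymm : ∀ i j x, h i j x = h j i x) (c a b : Fin n) (x : Fin n → ℝ) :
    frameDeriv c (frameTensor h a b) x
      = (if c = a then ∑ i, ballCoord i x * ∑ j, hypFrame b j x * h i j x else 0)
        + (if c = b then ∑ i, ballCoord i x * ∑ j, hypFrame a j x * h i j x else 0)
        + ballCoord a x * frameTensor h c b x + ballCoord b x * frameTensor h a c x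
        + ∑ k, hypFrame c k x * ∑ i, hypFrame a i x * ∑ j, hypFrame b j x * pd (h i j) k x := by
  have hE := fun a i => hasFrameDerivAt_hypFrame c a i x
  have hd : HasFrameDerivAt c (frameTensor h a b) _ x :=
    HasFrameDerivAt.sum fun i _ => (hE a i).mul (HasFrameDerivAt.sum fun j _ =>
      (hE b j).mul (HasFrameDerivAt.of_contDiff (hsmooth i j)))
  rw [hd.frameDeriv_eq]
  have e1 : ∑ i, hypFrame a i x * ∑ j, ballCoord j x * h i j x
      = ∑ i, ballCoord i x * ∑ j, hypFrame a j x * h i j x := by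
    simp only [Finset.mul_sum]
    rw [Finset.sum_comm]
    exact Finset.sum_congr rfl fun i _ => Finset.sum_congr rfl fun j _ => by
      rw [hsymm i j]; ring
  have e2 : ∑ k, hypFrame c k x * ∑ i, hypFrame a i x * ∑ j, hypFrame b j x * pd (h i j) k x
      = ∑ i, hypFrame a i x * ∑ j, hypFrame b j x * frameDeriv c (h i j) x := by
    simp only [frameDeriv_eq_sum, Finset.mul_sum]
    rw [Finset.sum_comm]
    refine Finset.sum_congr rfl fun i _ => ?_
    rw [Finset.sum_comm]
    exact Finset.sum_congr rfl fun j _ => Finset.sum_congr rfl fun k _ => by ring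
  rw [e2, ← e1]
  simp only [frameTensor, add_mul, mul_add, Finset.sum_add_distrib, Finset.mul_sum]
  split_ifs <;> simp [mul_assoc, mul_left_comm] <;> ring

/-- `hypFrame` identifies the coordinate expression of `∇h` with its frame expression. -/
lemma sum_hypFrame_covDh (hsmooth : ∀ i j, ContDiff ℝ (⊤ : ℕ∞) (h i j))
    (hsymm : ∀ i j x, h i j x = h j i x) (c a b : Fin n) (x : Fin n → ℝ) :
    ∑ k, hypFrame c k x * ∑ i, hypFrame a i x * ∑ j, hypFrame b j x * covDh h k i j x
      = frameCov h c a b x := by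
  set w : Fin n → ℝ := fun j => ∑ l, x l * h l j x with hw
  have hq : ∀ b, ∑ j, hypFrame b j x * w j
      = (1 + hypRad x) * ∑ i, ballCoord i x * ∑ j, hypFrame b j x * h i j x := fun b => by
    simp only [hw, Finset.mul_sum]
    rw [Finset.sum_comm]
    refine Finset.sum_congr rfl fun l _ => Finset.sum_congr rfl fun j _ => ?_
    rw [coord_eq_mul_ballCoord l x]; ring
  have hcov : ∀ k i j, covDh h k i j x = pd (h i j) k x + gbar k i x * w j + gbar k j x * w i :=
    fun k i j => by
      simp only [covDh, Gam_eq, hw, Finset.mul_sum, Finset.sum_add_distrib, sub_eq_add_neg,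
        neg_add, ← Finset.sum_neg_distrib, add_assoc]
      congr 2
      · exact Finset.sum_congr rfl fun l _ => by ring
      · exact Finset.sum_congr rfl fun l _ => by rw [hsymm i l]; ring
  have g1 : ∑ k, hypFrame c k x * ∑ i, hypFrame a i x * ∑ j, hypFrame b j x * (gbar k i x * w j)
      = (if c = a then 1 else 0) * ∑ j, hypFrame b j x * w j := by
    rw [← sum_hypFrame_mul_gbar c a x, Finset.sum_mul]
    refine Finset.sum_congr rfl fun k _ => ?_
    rw [Finset.sum_mul, Finset.mul_sum]
    refine Finset.sum_congr rfl fun i _ => ?_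
    simp only [Finset.mul_sum]
    exact Finset.sum_congr rfl fun j _ => by ring
  have g2 : ∑ k, hypFrame c k x * ∑ i, hypFrame a i x * ∑ j, hypFrame b j x * (gbar k j x * w i)
      = (if c = b then 1 else 0) * ∑ j, hypFrame a j x * w j := by
    rw [← sum_hypFrame_mul_gbar c b x, Finset.sum_mul]
    refine Finset.sum_congr rfl fun k _ => ?_
    rw [Finset.sum_mul]
    simp only [Finset.mul_sum]
    rw [Finset.sum_comm]
    exact Finset.sum_congr rfl fun i _ => Finset.sum_congr rfl fun j _ => by ring
  simp only [hcov, mul_add, Finset.sum_add_distrib, g1, g2]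
  rw [frameCov, frameDeriv_frameTensor hsmooth hsymm, hq, hq, frameBall_eq, frameBall_eq]
  split_ifs <;> ring

lemma hNormSq_eq (x : Fin n → ℝ) : hNormSq h x = ∑ a, ∑ b, frameTensor h a b x ^ 2 := by
  simp only [sq]
  exact sum_ginv_tensor x (fun i j => h i j x) fun i j => h i j x

lemma covDNormSq_sub_DbarNormSq (hsmooth : ∀ i j, ContDiff ℝ (⊤ : ℕ∞) (h i j))
    (hsymm : ∀ i j x, h i j x = h j i x) (x : Fin n → ℝ) :
    covDNormSq h x - DbarNormSq h x
      = ∑ a, ∑ b, ∑ c, frameCov h a b c x * frameCov h b a c x := by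
  have hD : ∀ a b c, ∑ i, hypFrame a i x * ∑ j, hypFrame b j x * ∑ k, hypFrame c k x
      * Dbar h i j k x = (frameCov h a b c x - frameCov h b a c x) / √2 := fun a b c => by
    rw [← sum_hypFrame_covDh hsmooth hsymm, ← sum_hypFrame_covDh hsmooth hsymm]
    simp only [Dbar, Finset.mul_sum]
    rw [Finset.sum_comm (f := fun k i => ∑ j, hypFrame b k x * _),
      ← Finset.sum_sub_distrib, Finset.sum_div]
    refine Finset.sum_congr rfl fun i _ => ?_
    rw [← Finset.sum_sub_distrib, Finset.sum_div]
    refine Finset.sum_congr rfl fun j _ => ?_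
    rw [← Finset.sum_sub_distrib, Finset.sum_div]
    exact Finset.sum_congr rfl fun k _ => by ring
  have hc : covDNormSq h x = ∑ a, ∑ b, ∑ c, frameCov h a b c x ^ 2 := by
    simp only [sq, ← sum_hypFrame_covDh hsmooth hsymm]
    exact sum_ginv_tensor₃ x (fun k i j => covDh h k i j x) fun k i j => covDh h k i j x
  have hd : DbarNormSq h x
      = ∑ a, ∑ b, ∑ c, ((frameCov h a b c x - frameCov h b a c x) / √2) ^ 2 := by
    simp only [sq, ← hD]
    exact sum_ginv_tensor₃ x (fun k i j => Dbar h k i j x) fun k i j => Dbar h k i j x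
  have hsw : ∑ a, ∑ b, ∑ c, frameCov h b a c x ^ 2 = ∑ a, ∑ b, ∑ c, frameCov h a b c x ^ 2 :=
    Finset.sum_comm
  have hd' : DbarNormSq h x = (1 / 2) * ∑ a, ∑ b, ∑ c, frameCov h a b c x ^ 2
      + (1 / 2) * ∑ a, ∑ b, ∑ c, frameCov h b a c x ^ 2
      - ∑ a, ∑ b, ∑ c, frameCov h a b c x * frameCov h b a c x := by
    rw [hd]
    simp only [Finset.mul_sum, ← Finset.sum_add_distrib, ← Finset.sum_sub_distrib]
    refine Finset.sum_congr rfl fun a _ => Finset.sum_congr rfl fun b _ =>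
      Finset.sum_congr rfl fun c _ => ?_
    rw [div_pow, Real.sq_sqrt (by norm_num)]; ring
  rw [hd', hc, hsw]; ring

lemma covecNormSq_eq (w : Fin n → (Fin n → ℝ) → ℝ) (x : Fin n → ℝ) :
    covecNormSq w x = ∑ a, (∑ i, hypFrame a i x * w i x) ^ 2 := by
  simp only [sq, ← sum_ginv_covec, covecNormSq, mul_assoc]

lemma sum_hypFrame_divBar (hsmooth : ∀ i j, ContDiff ℝ (⊤ : ℕ∞) (h i j))
    (hsymm : ∀ i j x, h i j x = h j i x) (b : Fin n) (x : Fin n → ℝ) :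
    ∑ j, hypFrame b j x * divBar h j x = -∑ a, frameCov h a a b x := by
  simp only [← sum_hypFrame_covDh hsmooth hsymm, divBar, mul_neg, Finset.sum_neg_distrib,
    ← sum_hypFrame_mul_hypFrame, Finset.mul_sum, Finset.sum_mul]
  congr 1
  rw [Finset.sum_comm (f := fun a i => ∑ k, ∑ j, hypFrame a i x * _), Finset.sum_comm]
  refine Finset.sum_congr rfl fun i _ => ?_
  rw [Finset.sum_comm, Finset.sum_comm (f := fun a k => ∑ j, hypFrame a i x * _)]
  refine Finset.sum_congr rfl fun k _ => ?_
  rw [Finset.sum_comm]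
  exact Finset.sum_congr rfl fun _ _ => Finset.sum_congr rfl fun _ _ => by ring

lemma sum_hypFrame_hdV (hsymm : ∀ i j x, h i j x = h j i x) (A0 : ℝ) (A : Fin n → ℝ)
    (a : Fin n) (x : Fin n → ℝ) :
    ∑ i, hypFrame a i x * hdV A0 A h i x
      = (Vpot A0 A x)⁻¹ * ∑ b, frameDeriv b (Vpot A0 A) x * frameTensor h b a x := by
  have e : ∀ i, ∑ j, ∑ k, h i j x * ginv j k x * pd (Vpot A0 A) k x
      = ∑ b, (∑ j, hypFrame b j x * h i j x) * frameDeriv b (Vpot A0 A) x := fun i => by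
    simp only [frameDeriv_eq_sum, ← sum_ginv_covec]
    exact Finset.sum_congr rfl fun _ _ => Finset.sum_congr rfl fun _ _ => by ring
  simp only [hdV, e, fun b => frameTensor_symm hsymm b a x]
  simp only [frameTensor, Finset.mul_sum, Finset.sum_mul]
  rw [Finset.sum_comm]
  exact Finset.sum_congr rfl fun _ _ => Finset.sum_congr rfl fun _ _ =>
    Finset.sum_congr rfl fun _ _ => by ring

end FrameTensor

section Divergence

variable {f : (Fin n → ℝ) → ℝ}

lemma sum_pd_mul_hypFrame (a : Fin n) (hf : ContDiff ℝ (⊤ : ℕ∞) f) (x : Fin n → ℝ) :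
    ∑ i, pd (fun y => f y * (hypFrame a i y * (hypRad y)⁻¹)) i x
      = (hypRad x)⁻¹ * (frameDeriv a f x + (n - 1) * ballCoord a x * f x) := by
  have h0 := (hypRad_pos x).ne'
  have h1 := (one_add_hypRad_pos x).ne'
  have hc : ∀ l : Fin n, HasFDerivAt (fun y : Fin n → ℝ => y l)
      (ContinuousLinearMap.proj (R := ℝ) (φ := fun _ : Fin n => ℝ) l) x :=
    fun l => (ContinuousLinearMap.proj (R := ℝ) (φ := fun _ : Fin n => ℝ) l).hasFDerivAt
  have hi : HasFDerivAt (𝕜 := ℝ) (fun y : Fin n → ℝ => (hypRad y)⁻¹) _ x :=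
    (hasDerivAt_inv (𝕜 := ℝ) h0).comp_hasFDerivAt x (hasFDerivAt_hypRad x)
  have hj : HasFDerivAt (𝕜 := ℝ) (fun y : Fin n → ℝ => (1 + hypRad y)⁻¹) _ x :=
    (hasDerivAt_inv (𝕜 := ℝ) h1).comp_hasFDerivAt x ((hasFDerivAt_hypRad x).const_add 1)
  have e : ∀ i, pd (fun y => f y * (hypFrame a i y * (hypRad y)⁻¹)) i x
      = (hypRad x)⁻¹ * (hypFrame a i x * pd f i x)
        + f x * ((if a = i then ballCoord i x * (hypRad x)⁻¹ else 0)
          + (hypRad x)⁻¹ * ballCoord a x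
          - x a * (hypRad x)⁻¹ ^ 2 * (1 + hypRad x)⁻¹ ^ 2 * x i ^ 2
          - (hypRad x)⁻¹ ^ 3 * (x i * hypFrame a i x)) := fun i => by
    have hd := ((hf.differentiable (by simp) x).hasFDerivAt).fun_mul
      ((((hc a).fun_mul ((hc i).fun_mul hj)).const_add (if a = i then (1 : ℝ) else 0)).fun_mul hi)
    have hs : ∀ l, (Pi.single i (1 : ℝ) : Fin n → ℝ) l = if i = l then 1 else 0 := fun l => by
      simp [Pi.single_apply, eq_comm]
    rw [pd]
    unfold hypFrame ballCoord
    rw [hd.fderiv]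
    simp only [add_apply, smul_apply, _root_.sum_apply, ContinuousLinearMap.proj_apply,
      smul_eq_mul, hs, mul_ite, mul_one, mul_zero, Finset.sum_ite_eq, Finset.mem_univ, if_true]
    rw [← pd]
    simp only [eq_comm (a := i) (b := a)]
    split_ifs <;> field_simp <;> ring
  simp only [e, Finset.sum_add_distrib, Finset.sum_sub_distrib, ← Finset.mul_sum,
    sum_coord_mul_hypFrame, sum_sq_eq, ← frameDeriv_eq_sum]
  simp only [Finset.sum_ite_eq, Finset.mem_univ, if_true, Finset.sum_const, Finset.card_univ,
    Fintype.card_fin, nsmul_eq_mul, ballCoord]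
  field_simp
  ring

lemma integrable_of_contDiff (hf : ContDiff ℝ (⊤ : ℕ∞) f) (hc : HasCompactSupport f) :
    Integrable f :=
  hf.continuous.integrable_of_hasCompactSupport hc

lemma integrable_pd (hf : ContDiff ℝ (⊤ : ℕ∞) f) (hc : HasCompactSupport f) (i : Fin n) :
    Integrable (pd f i) :=
  ((hf.continuous_fderiv (by simp)).clm_apply continuous_const).integrable_of_hasCompactSupport
    (hc.fderiv_apply ℝ _)

lemma integral_pd_eq_zero (hf : ContDiff ℝ (⊤ : ℕ∞) f) (hc : HasCompactSupport f) (i : Fin n) :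
    ∫ x, pd f i x = 0 := by
  have hp : Integrable fun x => fderiv ℝ f x (Pi.single i 1) := integrable_pd hf hc i
  have := integral_mul_fderiv_eq_neg_fderiv_mul_of_integrable (μ := (volume : Measure (Fin n → ℝ)))
    (f := fun _ => (1 : ℝ)) (g := f) (v := Pi.single i 1) (by simp)
    (by simpa using hp) (by simpa using integrable_of_contDiff hf hc)
    (fun _ _ => by fun_prop) fun x _ => hf.differentiable (by simp) x
  simpa [pd] using this

lemma integrable_and_integral_frameDiv (a : Fin n) (hf : ContDiff ℝ (⊤ : ℕ∞) f)
    (hc : HasCompactSupport f) :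
    Integrable (fun x => (hypRad x)⁻¹ * (frameDeriv a f x + (n - 1) * ballCoord a x * f x)) ∧
      ∫ x, (hypRad x)⁻¹ * (frameDeriv a f x + (n - 1) * ballCoord a x * f x) = 0 := by
  have hF : ∀ i, ContDiff ℝ (⊤ : ℕ∞) fun y => f y * (hypFrame a i y * (hypRad y)⁻¹) := fun i =>
    hf.mul ((contDiff_hypFrame a i).mul (contDiff_hypRad.inv fun y => (hypRad_pos y).ne'))
  have hC : ∀ i, HasCompactSupport fun y => f y * (hypFrame a i y * (hypRad y)⁻¹) :=
    fun i => hc.mul_right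
  simp only [← sum_pd_mul_hypFrame a hf]
  refine ⟨integrable_finsetSum _ fun i _ => integrable_pd (hF i) (hC i) i, ?_⟩
  rw [integral_finsetSum _ fun i _ => integrable_pd (hF i) (hC i) i]
  exact Finset.sum_eq_zero fun i _ => integral_pd_eq_zero (hF i) (hC i) i

end Divergence

section Potential

variable (A0 : ℝ) (A : Fin n → ℝ)

/-- The derivative of the static potential along the `a`-th frame vector. -/
def potDeriv (a : Fin n) (x : Fin n → ℝ) : ℝ :=
  A a + x a * (A0 + ∑ i, A i * ballCoord i x)

lemma contDiff_Vpot : ContDiff ℝ (⊤ : ℕ∞) (Vpot A0 A) := by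
  have : Vpot A0 A = fun x => A0 * hypRad x + ∑ i, A i * x i := rfl
  rw [this]
  have := @contDiff_hypRad n
  fun_prop

lemma contDiff_potDeriv (a : Fin n) : ContDiff ℝ (⊤ : ℕ∞) (potDeriv A0 A a) := by
  unfold potDeriv
  have := @contDiff_ballCoord n
  fun_prop

lemma hasFrameDerivAt_Vpot (a : Fin n) (x : Fin n → ℝ) :
    HasFrameDerivAt a (Vpot A0 A) (potDeriv A0 A a x) x := by
  refine (((HasFrameDerivAt.const A0).mul (hasFrameDerivAt_hypRad a x)).add
    (HasFrameDerivAt.sum fun i _ =>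
      (HasFrameDerivAt.const (A i)).mul (hasFrameDerivAt_coord a i x))).congr_deriv ?_
  have e : ∀ i, 0 * x i + A i * hypFrame a i x
      = (if a = i then A i else 0) + x a * (A i * ballCoord i x) := fun i => by
    unfold hypFrame; split_ifs <;> ring
  simp only [e, Finset.sum_add_distrib, ← Finset.mul_sum, potDeriv]
  simp
  ring

lemma Vpot_sub_sum_ballCoord_mul_potDeriv (x : Fin n → ℝ) :
    Vpot A0 A x - ∑ e, ballCoord e x * potDeriv A0 A e x = A0 + ∑ i, A i * ballCoord i x := by
  have e : ∀ e, ballCoord e x * potDeriv A0 A e x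
      = A e * ballCoord e x + x e * ballCoord e x * (A0 + ∑ i, A i * ballCoord i x) := fun e => by
    unfold potDeriv; ring
  have hx : ∑ i, A i * x i = (1 + hypRad x) * ∑ i, A i * ballCoord i x := by
    rw [Finset.mul_sum]
    exact Finset.sum_congr rfl fun i _ => by rw [coord_eq_mul_ballCoord i x]; ring
  simp only [e, Finset.sum_add_distrib, ← Finset.sum_mul, sum_coord_mul_ballCoord, Vpot, hx]
  rw [← hypRad]
  ring

/-- The Hessian of the static potential is `V ḡ`, expressed in the frame `hypFrame`. -/
lemma hasFrameDerivAt_potDeriv (a b : Fin n) (x : Fin n → ℝ) :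
    HasFrameDerivAt a (potDeriv A0 A b)
      (Vpot A0 A x * (if a = b then 1 else 0) + ballCoord b x * potDeriv A0 A a x
        - (if a = b then 1 else 0) * ∑ e, ballCoord e x * potDeriv A0 A e x) x := by
  refine ((HasFrameDerivAt.const (A b)).add ((hasFrameDerivAt_coord a b x).mul
    ((HasFrameDerivAt.const A0).add (HasFrameDerivAt.sum fun i _ =>
      (HasFrameDerivAt.const (A i)).mul (hasFrameDerivAt_ballCoord a i x))))).congr_deriv ?_
  have hV := Vpot_sub_sum_ballCoord_mul_potDeriv A0 A x
  have hs : ∑ i, (0 * ballCoord i x + A i * if a = i then (1 + hypRad x)⁻¹ else 0)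
      = A a * (1 + hypRad x)⁻¹ := by simp
  rw [hs]
  by_cases hab : a = b
  · subst hab
    simp only [if_true, mul_one, one_mul, add_sub_right_comm, hV, hypFrame]
    simp only [potDeriv, ballCoord]
    ring
  · simp only [hab, if_false, hypFrame, potDeriv, ballCoord]
    ring

lemma Vpot_pos (hA0 : 0 < A0) (hA : √(∑ i, A i ^ 2) ≤ A0) (x : Fin n → ℝ) :
    0 < Vpot A0 A x := by
  have h1 : ∑ i, A i ^ 2 ≤ A0 ^ 2 := (Real.sqrt_le_left hA0.le).1 hA
  have h2 : (∑ i, A i * x i) ^ 2 < (A0 * hypRad x) ^ 2 := by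
    calc (∑ i, A i * x i) ^ 2 ≤ (∑ i, A i ^ 2) * ∑ i, x i ^ 2 :=
          Finset.sum_mul_sq_le_sq_mul_sq _ _ _
      _ ≤ A0 ^ 2 * ∑ i, x i ^ 2 := by gcongr
      _ < A0 ^ 2 * hypRad x ^ 2 := by
          rw [hypRad_sq]
          exact mul_lt_mul_of_pos_left (by linarith) (by positivity)
      _ = _ := by ring
  have := (abs_lt_of_sq_lt_sq' h2 (mul_pos hA0 (hypRad_pos x)).le).1
  unfold Vpot
  rw [← hypRad]
  linarith

end Potential

section Flux

variable {h : Fin n → Fin n → (Fin n → ℝ) → ℝ}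

/-- A vector field, given in the frame `hypFrame`, whose divergence is the integrand of the
unweighted identity. -/
def frameFlux (h : Fin n → Fin n → (Fin n → ℝ) → ℝ) (a : Fin n) (x : Fin n → ℝ) : ℝ :=
  ∑ b, ∑ c, frameTensor h b c x * frameDeriv b (frameTensor h a c) x
    - ballCoord a x * ∑ b, ∑ c, frameTensor h b c x ^ 2
    - ∑ c, frameTensor h a c x * ∑ b, frameDeriv b (frameTensor h b c) x
    - n * ∑ c, frameTensor h a c x * frameBall h c x

/-- The correction of `V • frameFlux` by the contraction of `dV` with the square of the tensor. -/
def weightedFlux (A0 : ℝ) (A : Fin n → ℝ) (h : Fin n → Fin n → (Fin n → ℝ) → ℝ) (a : Fin n)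
    (x : Fin n → ℝ) : ℝ :=
  Vpot A0 A x * frameFlux h a x
    - ∑ b, ∑ c, potDeriv A0 A b x * (frameTensor h a c x * frameTensor h b c x)

lemma contDiff_frameBall (hsmooth : ∀ i j, ContDiff ℝ (⊤ : ℕ∞) (h i j)) (c : Fin n) :
    ContDiff ℝ (⊤ : ℕ∞) (frameBall h c) := by
  unfold frameBall
  have := @contDiff_ballCoord n
  have := contDiff_frameTensor hsmooth
  fun_prop

lemma contDiff_frameFlux (hsmooth : ∀ i j, ContDiff ℝ (⊤ : ℕ∞) (h i j)) (a : Fin n) :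
    ContDiff ℝ (⊤ : ℕ∞) (frameFlux h a) := by
  unfold frameFlux
  have := @contDiff_ballCoord n
  have := contDiff_frameTensor hsmooth
  have := contDiff_frameBall hsmooth
  have := fun c a b => contDiff_frameDeriv c (contDiff_frameTensor hsmooth a b)
  fun_prop

lemma contDiff_weightedFlux (hsmooth : ∀ i j, ContDiff ℝ (⊤ : ℕ∞) (h i j)) (A0 : ℝ)
    (A : Fin n → ℝ) (a : Fin n) : ContDiff ℝ (⊤ : ℕ∞) (weightedFlux A0 A h a) := by
  unfold weightedFlux
  have := contDiff_frameTensor hsmooth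
  have := contDiff_frameFlux hsmooth
  have := contDiff_Vpot A0 A
  have := contDiff_potDeriv A0 A
  fun_prop

lemma frameTensor_eq_zero {x : Fin n → ℝ} (hx : ∀ i j, h i j x = 0) (a b : Fin n) :
    frameTensor h a b x = 0 := by
  simp [frameTensor, hx]

lemma weightedFlux_eq_zero {x : Fin n → ℝ} (hx : ∀ i j, h i j x = 0) (A0 : ℝ) (A : Fin n → ℝ)
    (a : Fin n) : weightedFlux A0 A h a x = 0 := by
  simp [weightedFlux, frameFlux, frameTensor_eq_zero hx]

lemma hasCompactSupport_of_forall_eq_zero (hsupp : ∀ i j, HasCompactSupport (h i j))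
    {f : (Fin n → ℝ) → ℝ} (hf : ∀ x, (∀ i j, h i j x = 0) → f x = 0) : HasCompactSupport f := by
  refine HasCompactSupport.intro (K := ⋃ i, ⋃ j, tsupport (h i j))
    (isCompact_iUnion fun i => isCompact_iUnion fun j => hsupp i j) fun x hx => hf x fun i j => ?_
  simp only [Set.mem_iUnion, not_exists] at hx
  exact image_eq_zero_of_notMem_tsupport (hx i j)

lemma hasFrameDerivAt_frameBall (hsmooth : ∀ i j, ContDiff ℝ (⊤ : ℕ∞) (h i j)) (a c : Fin n)
    (x : Fin n → ℝ) :
    HasFrameDerivAt a (frameBall h c) ((1 + hypRad x)⁻¹ * frameTensor h a c x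
      + ∑ e, ballCoord e x * frameDeriv a (frameTensor h e c) x) x := by
  refine (HasFrameDerivAt.sum fun e _ => (hasFrameDerivAt_ballCoord a e x).mul
    (HasFrameDerivAt.of_contDiff (contDiff_frameTensor hsmooth e c))).congr_deriv ?_
  simp [Finset.sum_add_distrib]

lemma hasFrameDerivAt_frameFlux (hsmooth : ∀ i j, ContDiff ℝ (⊤ : ℕ∞) (h i j)) (a : Fin n)
    (x : Fin n → ℝ) :
    HasFrameDerivAt a (frameFlux h a)
      (∑ b, ∑ c, (frameDeriv a (frameTensor h b c) x * frameDeriv b (frameTensor h a c) x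
          + frameTensor h b c x * frameDeriv a (frameDeriv b (frameTensor h a c)) x)
        - ((1 + hypRad x)⁻¹ * ∑ b, ∑ c, frameTensor h b c x ^ 2
          + ballCoord a x
            * ∑ b, ∑ c, 2 * frameTensor h b c x * frameDeriv a (frameTensor h b c) x)
        - ∑ c, (frameDeriv a (frameTensor h a c) x * ∑ b, frameDeriv b (frameTensor h b c) x
          + frameTensor h a c x * ∑ b, frameDeriv a (frameDeriv b (frameTensor h b c)) x)
        - n * ∑ c, (frameDeriv a (frameTensor h a c) x * frameBall h c x
          + frameTensor h a c x * ((1 + hypRad x)⁻¹ * frameTensor h a c x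
            + ∑ e, ballCoord e x * frameDeriv a (frameTensor h e c) x))) x := by
  have hT : ∀ b c, HasFrameDerivAt a (frameTensor h b c) (frameDeriv a (frameTensor h b c) x) x :=
    fun b c => HasFrameDerivAt.of_contDiff (contDiff_frameTensor hsmooth b c)
  have hdT : ∀ e b c, HasFrameDerivAt a (frameDeriv e (frameTensor h b c))
      (frameDeriv a (frameDeriv e (frameTensor h b c)) x) x := fun e b c =>
    HasFrameDerivAt.of_contDiff (contDiff_frameDeriv e (contDiff_frameTensor hsmooth b c))
  have hT2 : ∀ b c, HasFrameDerivAt a (fun y => frameTensor h b c y ^ 2)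
      (2 * frameTensor h b c x * frameDeriv a (frameTensor h b c) x) x := fun b c => by
    simp only [sq]
    exact ((hT b c).mul (hT b c)).congr_deriv (by ring)
  refine ((((HasFrameDerivAt.sum fun b _ => HasFrameDerivAt.sum fun c _ =>
    (hT b c).mul (hdT b a c)).sub ((hasFrameDerivAt_ballCoord a a x).mul
      (HasFrameDerivAt.sum fun b _ => HasFrameDerivAt.sum fun c _ => hT2 b c))).sub
    (HasFrameDerivAt.sum fun c _ => (hT a c).mul
      (HasFrameDerivAt.sum fun b _ => hdT b b c))).sub
    ((HasFrameDerivAt.const (n : ℝ)).mul (HasFrameDerivAt.sum fun c _ =>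
      (hT a c).mul (hasFrameDerivAt_frameBall hsmooth a c x)))).congr_deriv ?_
  simp only [if_true, zero_mul, zero_add]

lemma sum_frameDiv_weightedFlux (hsmooth : ∀ i j, ContDiff ℝ (⊤ : ℕ∞) (h i j))
    (hsymm : ∀ i j x, h i j x = h j i x)
    (htracefree : ∀ x, (∑ i, ∑ j, ginv i j x * h i j x) = 0)
    (A0 : ℝ) (A : Fin n → ℝ) (x : Fin n → ℝ) :
    ∑ a, (frameDeriv a (weightedFlux A0 A h a) x
        + (n - 1) * ballCoord a x * weightedFlux A0 A h a x)
      = Vpot A0 A x * (∑ a, ∑ b, ∑ c, frameCov h a b c x * frameCov h b a c x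
          - ∑ c, (∑ b, frameCov h b b c x) ^ 2)
        - (n + 1) * (Vpot A0 A x * ∑ b, ∑ c, frameTensor h b c x ^ 2)
        - 2 * ∑ c, (∑ b, frameCov h b b c x) * ∑ b, potDeriv A0 A b x * frameTensor h b c x := by
  have hT : ∀ a b c, HasFrameDerivAt a (frameTensor h b c) (frameDeriv a (frameTensor h b c) x) x :=
    fun a b c => HasFrameDerivAt.of_contDiff (contDiff_frameTensor hsmooth b c)
  have hZ : ∀ a, HasFrameDerivAt a
      (fun y => ∑ b, ∑ c, potDeriv A0 A b y * (frameTensor h a c y * frameTensor h b c y)) _ x :=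
    fun a => HasFrameDerivAt.sum fun b _ => HasFrameDerivAt.sum fun c _ =>
      (hasFrameDerivAt_potDeriv A0 A a b x).mul ((hT a a c).mul (hT a b c))
  have hW := fun a => ((hasFrameDerivAt_Vpot A0 A a x).mul
    (hasFrameDerivAt_frameFlux hsmooth a x)).sub (hZ a)
  have htr : ∀ y, ∑ a, frameTensor h a a y = 0 := fun y => by
    rw [sum_frameTensor_self, htracefree]
  have hsy : ∀ a b, frameTensor h a b = frameTensor h b a := fun a b =>
    funext fun y => frameTensor_symm hsymm a b y
  have hdtr : ∀ c, ∑ a, frameDeriv c (frameTensor h a a) x = 0 := fun c => by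
    have h1 := (HasFrameDerivAt.sum (s := Finset.univ) fun a _ => hT c a a).frameDeriv_eq
    simp only [htr] at h1
    rw [← h1, (HasFrameDerivAt.const 0).frameDeriv_eq]
  have s2 := sum_div_second_order (1 + hypRad x)⁻¹ (fun a => ballCoord a x)
    (fun c => frameBall h c x) (fun c => ∑ b, frameDeriv b (frameTensor h b c) x)
    (fun a => frameFlux h a x) _ (fun a b => frameTensor h a b x)
    (fun a b c => frameDeriv a (frameTensor h b c) x) (fun a b c => frameCov h a b c x)
    (fun a b c e => frameDeriv a (frameDeriv b (frameTensor h c e)) x)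
    (fun a b => by rw [hsy]) (fun c a b => by rw [hsy]) (htr x) hdtr (fun _ => rfl)
    (fun _ => rfl) (fun _ _ _ => rfl) (sum_ballCoord_sq x)
    (fun a b c e => frameDeriv_comm a b (contDiff_frameTensor hsmooth c e) x)
    (fun a => by rw [Fintype.card_fin]; rfl) (fun a => rfl)
  have s1 := sum_div_first_order (Vpot A0 A x) (fun a => ballCoord a x)
    (fun a => potDeriv A0 A a x) (fun c => frameBall h c x)
    (fun c => ∑ b, frameDeriv b (frameTensor h b c) x)
    (fun a => frameFlux h a x) _ (fun a b => frameTensor h a b x)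
    (fun a b c => frameDeriv a (frameTensor h b c) x) (fun a b c => frameCov h a b c x)
    (htr x) (fun _ => rfl) (fun _ => rfl) (fun _ _ _ => rfl)
    (fun a => by rw [Fintype.card_fin]; rfl) (fun a => rfl)
  have e : ∀ a, frameDeriv a (weightedFlux A0 A h a) x = _ := fun a => (hW a).frameDeriv_eq
  simp only [Fintype.card_fin] at s1 s2
  have key : ∀ V Q N D P : ℝ, ∀ w d z U u : Fin n → ℝ,
      ∑ a, (d a + (n - 1) * ballCoord a x * U a) = Q - n * N →
      ∑ a, (w a * U a - (z a + (n - 1) * ballCoord a x * u a)) = - V * N - 2 * P →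
      ∑ a, (w a * U a + V * d a - z a + (n - 1) * ballCoord a x * (V * U a - u a))
        = V * Q - (n + 1) * (V * N) - 2 * P := by
    intro V Q N D P w d z U u k1 k2
    have : ∀ a, w a * U a + V * d a - z a + (n - 1) * ballCoord a x * (V * U a - u a)
        = V * (d a + (n - 1) * ballCoord a x * U a)
          + (w a * U a - (z a + (n - 1) * ballCoord a x * u a)) := fun a => by ring
    simp only [this, Finset.sum_add_distrib, ← Finset.mul_sum] at k1 k2 ⊢
    rw [k1, k2]; ring
  simp only [e]
  exact key _ _ _ 0 _ _ _ _ _ _ s2 s1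

lemma weighted_integrand_eq (hsmooth : ∀ i j, ContDiff ℝ (⊤ : ℕ∞) (h i j))
    (hsymm : ∀ i j x, h i j x = h j i x)
    (htracefree : ∀ x, (∑ i, ∑ j, ginv i j x * h i j x) = 0)
    (A0 : ℝ) (A : Fin n → ℝ) (x : Fin n → ℝ) (hV : Vpot A0 A x ≠ 0) :
    ((covDNormSq h x - DbarNormSq h x
        - covecNormSq (fun j y => divBar h j y - hdV A0 A h j y) x)
      + covecNormSq (hdV A0 A h) x) * Vpot A0 A x * (hypRad x)⁻¹
    = (n + 1) * (hNormSq h x * Vpot A0 A x * (hypRad x)⁻¹)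
      + ∑ a, (hypRad x)⁻¹ * (frameDeriv a (weightedFlux A0 A h a) x
        + (n - 1) * ballCoord a x * weightedFlux A0 A h a x) := by
  have e : ∀ a, ∑ i, hypFrame a i x * (divBar h i x - hdV A0 A h i x)
      = -∑ b, frameCov h b b a x
        - (Vpot A0 A x)⁻¹ * ∑ b, potDeriv A0 A b x * frameTensor h b a x := fun a => by
    simp only [mul_sub, Finset.sum_sub_distrib, sum_hypFrame_divBar hsmooth hsymm,
      sum_hypFrame_hdV hsymm, (hasFrameDerivAt_Vpot A0 A _ x).frameDeriv_eq]
  rw [← Finset.mul_sum, sum_frameDiv_weightedFlux hsmooth hsymm htracefree,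
    covDNormSq_sub_DbarNormSq hsmooth hsymm, covecNormSq_eq, covecNormSq_eq, hNormSq_eq]
  simp only [e, sum_hypFrame_hdV hsymm, (hasFrameDerivAt_Vpot A0 A _ x).frameDeriv_eq]
  have sq_expand : ∀ D P : Fin n → ℝ, ∑ a, (-D a - (Vpot A0 A x)⁻¹ * P a) ^ 2
      = ∑ a, D a ^ 2 + 2 * (Vpot A0 A x)⁻¹ * ∑ a, D a * P a
        + ∑ a, ((Vpot A0 A x)⁻¹ * P a) ^ 2 := fun D P => by
    rw [Finset.mul_sum, ← Finset.sum_add_distrib, ← Finset.sum_add_distrib]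
    exact Finset.sum_congr rfl fun a _ => by ring
  rw [sq_expand]
  field_simp
  ring

end Flux

end HyperbolicFrame

/-- the weighted integral identity
`∫ |ĥ|²_ḡ V dμ = (1/(n+1)) ∫ [(|∇̄ĥ|²_ḡ − |D̄ĥ|²_ḡ − |div̄ ĥ − ĥ_{dV}|²_ḡ) + |ĥ_{dV}|²_ḡ] V dμ`
for smooth compactly supported `ḡ`-trace-free symmetric 2-tensors on hyperbolic
space, where `dμ = (1+‖x‖²)^{−1/2} dx` is the hyperbolic volume measure. -/
theorem weighted_integral_identity (n : ℕ) (hn : 2 ≤ n)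
    (A0 : ℝ) (hA0 : 0 < A0) (A : Fin n → ℝ) (hA : Real.sqrt (∑ i, A i ^ 2) ≤ A0)
    (h : Fin n → Fin n → (Fin n → ℝ) → ℝ)
    (hsmooth : ∀ i j, ContDiff ℝ (⊤ : ℕ∞) (h i j))
    (hsupp : ∀ i j, HasCompactSupport (h i j))
    (hsymm : ∀ i j x, h i j x = h j i x)
    (htracefree : ∀ x, (∑ i, ∑ j, ginv i j x * h i j x) = 0) :
    (∫ x : Fin n → ℝ,
        hNormSq h x * Vpot A0 A x * (Real.sqrt (1 + ∑ k, x k ^ 2))⁻¹)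
      = (1 / ((n : ℝ) + 1)) * ∫ x : Fin n → ℝ,
          ((covDNormSq h x - DbarNormSq h x
              - covecNormSq (fun j y => divBar h j y - hdV A0 A h j y) x)
            + covecNormSq (hdV A0 A h) x)
            * Vpot A0 A x * (Real.sqrt (1 + ∑ k, x k ^ 2))⁻¹ := by
  set v : Fin n → (Fin n → ℝ) → ℝ := fun a x => (hypRad x)⁻¹ *
    (frameDeriv a (weightedFlux A0 A h a) x + (n - 1) * ballCoord a x * weightedFlux A0 A h a x)
    with hv
  have hW : ∀ a, Integrable (v a) ∧ ∫ x, v a x = 0 := fun a =>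
    integrable_and_integral_frameDiv a (contDiff_weightedFlux hsmooth A0 A a)
      (hasCompactSupport_of_forall_eq_zero hsupp fun x hx => weightedFlux_eq_zero hx A0 A a)
  have hN : Integrable fun x => hNormSq h x * Vpot A0 A x * (hypRad x)⁻¹ := by
    refine integrable_of_contDiff ?_ (hasCompactSupport_of_forall_eq_zero hsupp fun x hx => ?_)
    · simp only [hNormSq_eq]
      have := contDiff_frameTensor hsmooth
      have := contDiff_Vpot A0 A
      exact ContDiff.mul (by fun_prop) (contDiff_hypRad.inv fun x => (hypRad_pos x).ne')
    · simp [hNormSq_eq, frameTensor_eq_zero hx]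
  have hn1 : (n : ℝ) + 1 ≠ 0 := by positivity
  simp only [fun x : Fin n → ℝ => show √(1 + ∑ k, x k ^ 2) = hypRad x from rfl,
    fun x => weighted_integrand_eq hsmooth hsymm htracefree A0 A x
    (Vpot_pos A0 A hA0 hA x).ne']
  rw [integral_add (hN.const_mul _) (integrable_finsetSum _ fun a _ => (hW a).1),
    integral_finsetSum _ fun a _ => (hW a).1, integral_const_mul,
    Finset.sum_eq_zero fun a _ => (hW a).2]
  field_simp
  ring
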